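/- arXiv:1609.05443 — 4 statements merged into one kernel-verified Lean document; each statement's English description precedes it below -/
import Mathlib

section
/- For every 0 < ν < 1 and every real s > 0, the Mellin transform of the Mainardi function satisfies ∫₀^∞ x^{s−1} M_ν(x) dx = Γ(s)/Γ(1 − ν + νs); in particular the integral converges. -/
open Real MeasureTheory Set

/-- The Mainardi function `M_ν(x) = Σ_{n=0}^∞ (−x)^n/(n! · Γ(1 − ν − νn))`. -/
noncomputable def mainardi (ν x : ℝ) : ℝ :=
  ∑' n : ℕ, (-x) ^ n / ((n.factorial : ℝ) * Real.Gamma (1 - ν - ν * n))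

namespace Mainardi

lemma integrableOn_rpow_mul_exp_neg {a c : ℝ} (ha : 0 < a) (hc : 0 < c) :
    IntegrableOn (fun t : ℝ => t ^ (a - 1) * rexp (-(c * t))) (Ioi 0) := by
  simpa using integrableOn_rpow_mul_exp_neg_mul_rpow (p := 1) (s := a - 1) (b := c)
    (by linarith) one_pos hc

lemma measurable_rpow_mul_cexp_neg (a : ℝ) (z : ℂ) :
    Measurable (fun t : ℝ => ((t ^ (a - 1) : ℝ) : ℂ) * Complex.exp (-(z * t))) := by
  fun_prop

lemma norm_rpow_mul_cexp_neg (a : ℝ) (z : ℂ) {t : ℝ} (ht : 0 < t) :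
    ‖((t ^ (a - 1) : ℝ) : ℂ) * Complex.exp (-(z * t))‖ = t ^ (a - 1) * rexp (-(z.re * t)) := by
  rw [norm_mul, Complex.norm_exp, Complex.norm_real, Real.norm_of_nonneg (by positivity)]
  simp

lemma integrableOn_rpow_mul_cexp_neg {a : ℝ} (ha : 0 < a) {z : ℂ} (hz : 0 < z.re) :
    IntegrableOn (fun t : ℝ => ((t ^ (a - 1) : ℝ) : ℂ) * Complex.exp (-(z * t))) (Ioi 0) := by
  refine (integrableOn_rpow_mul_exp_neg ha hz).mono'
    (measurable_rpow_mul_cexp_neg a z).aestronglyMeasurable ?_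
  filter_upwards [ae_restrict_mem measurableSet_Ioi] with t ht
  exact (norm_rpow_mul_cexp_neg a z ht).le

lemma differentiableAt_integral_rpow_mul_cexp_neg {a : ℝ} (ha : 0 < a) {z : ℂ} (hz : 0 < z.re) :
    DifferentiableAt ℂ (fun z : ℂ => ∫ t in Ioi (0 : ℝ),
      ((t ^ (a - 1) : ℝ) : ℂ) * Complex.exp (-(z * t))) z := by
  have hs : {w : ℂ | z.re / 2 < w.re} ∈ nhds z :=
    (isOpen_lt continuous_const Complex.continuous_re).mem_nhds (by simp; linarith)
  refine (hasDerivAt_integral_of_dominated_loc_of_deriv_le hs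
    (F' := fun w t => ((t ^ (a - 1) : ℝ) : ℂ) * (Complex.exp (-(w * t)) * -t))
    (bound := fun t => t ^ (a + 1 - 1) * rexp (-(z.re / 2 * t)))
    (.of_forall fun w => (measurable_rpow_mul_cexp_neg a w).aestronglyMeasurable)
    (integrableOn_rpow_mul_cexp_neg ha hz) (by fun_prop) ?_
    (integrableOn_rpow_mul_exp_neg (by linarith) (by linarith)) ?_).right.differentiableAt
  · filter_upwards [ae_restrict_mem measurableSet_Ioi] with t ht w hw
    have ht' : (0 : ℝ) < t := ht
    rw [← mul_assoc, norm_mul, norm_rpow_mul_cexp_neg a w ht', norm_neg, Complex.norm_real,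
      Real.norm_of_nonneg ht'.le, add_sub_right_comm, Real.rpow_add_one ht'.ne']
    have : rexp (-(w.re * t)) ≤ rexp (-(z.re / 2 * t)) := by
      have : z.re / 2 * t ≤ w.re * t := mul_le_mul_of_nonneg_right (le_of_lt hw) ht'.le
      exact Real.exp_le_exp.2 (by linarith)
    calc t ^ (a - 1) * rexp (-(w.re * t)) * t = t ^ (a - 1) * t * rexp (-(w.re * t)) := by ring
      _ ≤ _ := by gcongr
  · filter_upwards with t w _
    refine HasDerivAt.const_mul _ (HasDerivAt.cexp ?_)
    simpa using (hasDerivAt_mul_const (x := w) (t : ℂ)).fun_neg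

/-- The Gamma integral along a ray in the right half-plane. -/
lemma integral_rpow_mul_cexp_neg {a : ℝ} (ha : 0 < a) {z : ℂ} (hz : 0 < z.re) :
    ∫ t in Ioi (0 : ℝ), ((t ^ (a - 1) : ℝ) : ℂ) * Complex.exp (-(z * t)) =
      z ^ (-(a : ℂ)) * (Real.Gamma a : ℂ) := by
  have hopen : IsOpen {w : ℂ | 0 < w.re} := isOpen_lt continuous_const Complex.continuous_re
  have hF : AnalyticOnNhd ℂ (fun z : ℂ => ∫ t in Ioi (0 : ℝ),
      ((t ^ (a - 1) : ℝ) : ℂ) * Complex.exp (-(z * t))) {w : ℂ | 0 < w.re} :=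
    DifferentiableOn.analyticOnNhd (fun w hw =>
      (differentiableAt_integral_rpow_mul_cexp_neg ha hw).differentiableWithinAt) hopen
  have hG : AnalyticOnNhd ℂ (fun z : ℂ => z ^ (-(a : ℂ)) * (Real.Gamma a : ℂ))
      {w : ℂ | 0 < w.re} :=
    DifferentiableOn.analyticOnNhd (fun w hw =>
      ((differentiableAt_id.cpow_const (Or.inl hw)).mul_const _).differentiableWithinAt) hopen
  refine hF.eqOn_of_preconnected_of_frequently_eq hG
    (convex_halfSpace_re_gt 0).isPreconnected (z₀ := 1) (by simp) ?_ hz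
  refine Filter.Tendsto.frequently (f := fun r : ℝ => (r : ℂ)) (l₁ := nhdsWithin 1 {1}ᶜ) ?_
    (Filter.Eventually.frequently ?_)
  · refine tendsto_nhdsWithin_iff.2 ⟨?_, ?_⟩
    · exact (Complex.continuous_ofReal.tendsto' 1 1 (by simp)).mono_left nhdsWithin_le_nhds
    · filter_upwards [self_mem_nhdsWithin] with r hr
      simpa using hr
  · filter_upwards [mem_nhdsWithin_of_mem_nhds (lt_mem_nhds (zero_lt_one' ℝ))] with r hr
    have := Complex.integral_cpow_mul_exp_neg_mul_Ioi (a := a) (r := r) (by simpa) hr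
    rw [Complex.Gamma_ofReal] at this
    rw [Complex.cpow_neg, ← one_div, ← Complex.ofReal_cpow hr.le]
    rw [one_div,
      Complex.inv_cpow _ _ (by simp [Complex.arg_ofReal_of_nonneg hr.le, pi_pos.ne]),
      ← Complex.ofReal_cpow hr.le, ← one_div] at this
    rw [← this]
    refine setIntegral_congr_fun measurableSet_Ioi fun t ht => ?_
    simp [Complex.ofReal_cpow (le_of_lt ht)]

lemma mul_exp_mul_I_cpow {x θ : ℝ} (hx : 0 < x) (h₁ : -π < θ) (h₂ : θ < π) (b : ℝ) :
    ((x : ℂ) * Complex.exp (θ * Complex.I)) ^ (b : ℂ) =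
      ((x ^ b : ℝ) : ℂ) * Complex.exp ((b * θ : ℝ) * Complex.I) := by
  have hx' : (x : ℂ) = Complex.exp (Real.log x : ℝ) := by
    rw [← Complex.ofReal_exp, Real.exp_log hx]
  rw [Real.rpow_def_of_pos hx, Complex.ofReal_exp, ← Complex.exp_add,
    Complex.cpow_def_of_ne_zero (mul_ne_zero (by exact_mod_cast hx.ne') (Complex.exp_ne_zero _)),
    hx', ← Complex.exp_add, Complex.log_exp (by simpa using h₁) (by simpa using h₂.le)]
  congr 1
  push_cast
  ring

lemma neg_cos_pos_of_ray {φ : ℝ} (h₁ : π / 2 < φ) (h₂ : φ < π) : 0 < -cos φ := by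
  linarith [Real.cos_neg_of_pi_div_two_lt_of_lt h₁ (by linarith)]

lemma integral_rpow_mul_cexp_ray {φ : ℝ} (h₁ : π / 2 < φ) (h₂ : φ < π) {a : ℝ} (ha : 0 < a) :
    (∫ t in Ioi (0 : ℝ), ((t ^ (a - 1) : ℝ) : ℂ) *
      Complex.exp (-(-Complex.exp (φ * Complex.I) * t))) * Complex.exp ((a * φ : ℝ) * Complex.I) =
      (Real.Gamma a : ℂ) * Complex.exp ((π * a : ℝ) * Complex.I) := by
  have hre : 0 < (-Complex.exp (φ * Complex.I)).re := by
    rw [Complex.neg_re, Complex.exp_ofReal_mul_I_re]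
    exact neg_cos_pos_of_ray h₁ h₂
  have hz : -Complex.exp (φ * Complex.I) =
      ((1 : ℝ) : ℂ) * Complex.exp ((φ - π : ℝ) * Complex.I) := by
    rw [Complex.ofReal_sub, sub_mul, Complex.exp_sub, Complex.exp_pi_mul_I]
    simp [div_neg]
  rw [integral_rpow_mul_cexp_neg ha hre, hz, ← Complex.ofReal_neg,
    mul_exp_mul_I_cpow one_pos (by linarith) (by linarith), Real.one_rpow, mul_right_comm,
    mul_assoc (Complex.ofReal 1), ← Complex.exp_add, mul_comm, Complex.ofReal_one, one_mul]
  congr 2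
  push_cast
  ring

lemma Gamma_mul_sin_eq {a : ℝ} (ha : 0 < a) :
    Real.Gamma a * Real.sin (π * a) / π = (Real.Gamma (1 - a))⁻¹ := by
  have h := Real.Gamma_mul_Gamma_one_sub a
  have hΓ := (Real.Gamma_pos_of_pos ha).ne'
  by_cases hs : Real.sin (π * a) = 0
  · rw [hs, div_zero, mul_eq_zero] at h
    simp [hs, h.resolve_left hΓ]
  · have h1 : Real.Gamma (1 - a) ≠ 0 := by
      intro h0
      rw [h0, mul_zero, eq_comm, div_eq_zero_iff] at h
      exact h.elim pi_ne_zero hs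
    rw [eq_div_iff hs] at h
    field_simp
    linarith

lemma mul_rpow_le_add {ν c x : ℝ} (hν0 : 0 < ν) (hν1 : ν < 1) (hc : 0 < c) (hx : 0 ≤ x) :
    ∃ C : ℝ, ∀ r : ℝ, 0 < r → x * r ^ ν ≤ c * r + C := by
  set B : ℝ := (x * c⁻¹ ^ ν) ^ (1 - ν)⁻¹ with hB
  have hB0 : 0 ≤ B := by positivity
  refine ⟨B, fun r hr => ?_⟩
  have h := Real.geom_mean_le_arith_mean2_weighted hν0.le (sub_nonneg.2 hν1.le)
    (mul_pos hc hr).le hB0 (by ring)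
  have hBp : B ^ (1 - ν) = x * c⁻¹ ^ ν := by
    rw [hB, ← Real.rpow_mul (by positivity), inv_mul_cancel₀ (by linarith), Real.rpow_one]
  have hcc : c ^ ν * c⁻¹ ^ ν = 1 := by
    rw [← Real.mul_rpow hc.le (by positivity), mul_inv_cancel₀ hc.ne', Real.one_rpow]
  rw [hBp, Real.mul_rpow hc.le hr.le] at h
  have h1 : ν * (c * r) ≤ c * r := mul_le_of_le_one_left (by positivity) hν1.le
  have h2 : (1 - ν) * B ≤ B := mul_le_of_le_one_left hB0 (by linarith)
  calc x * r ^ ν = (c ^ ν * c⁻¹ ^ ν) * (x * r ^ ν) := by rw [hcc, one_mul]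
    _ = c ^ ν * r ^ ν * (x * c⁻¹ ^ ν) := by ring
    _ ≤ _ := by linarith

lemma integrableOn_rpow_mul_exp_neg_mul_exp_rpow {ν c x : ℝ} (hν0 : 0 < ν) (hν1 : ν < 1)
    (hc : 0 < c) (hx : 0 ≤ x) :
    IntegrableOn (fun r : ℝ => r ^ (ν - 1) * rexp (-(c * r)) * rexp (x * r ^ ν)) (Ioi 0) := by
  obtain ⟨C, hC⟩ := mul_rpow_le_add hν0 hν1 (half_pos hc) hx
  refine ((integrableOn_rpow_mul_exp_neg hν0 (half_pos hc)).const_mul (rexp C)).mono'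
    (by fun_prop) ?_
  filter_upwards [ae_restrict_mem measurableSet_Ioi] with r hr
  have hr' : (0 : ℝ) < r := hr
  rw [Real.norm_of_nonneg (by positivity), mul_left_comm, mul_assoc, ← Real.exp_add,
    ← Real.exp_add]
  refine mul_le_mul_of_nonneg_left (Real.exp_le_exp.2 ?_) (by positivity)
  linarith [hC r hr']

/-- The integrand obtained by restricting `σ ↦ exp (σ - x σ ^ ν) σ ^ (ν - 1)` to the ray of
argument `φ`. -/
noncomputable def kernel (ν φ x r : ℝ) : ℂ :=
  ((r ^ (ν - 1) : ℝ) : ℂ) * Complex.exp (-(-Complex.exp (φ * Complex.I) * r)) *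
    Complex.exp ((ν * φ : ℝ) * Complex.I) *
      Complex.exp (-(x * (r ^ ν : ℝ) : ℝ) * Complex.exp ((ν * φ : ℝ) * Complex.I))

lemma norm_kernel (ν φ x : ℝ) {r : ℝ} (hr : 0 < r) :
    ‖kernel ν φ x r‖ =
      r ^ (ν - 1) * rexp (-(-cos φ * r)) * rexp (-(x * r ^ ν * cos (ν * φ))) := by
  rw [kernel, norm_mul, norm_mul, norm_rpow_mul_cexp_neg _ _ hr, Complex.norm_exp_ofReal_mul_I,
    Complex.norm_exp, ← Complex.ofReal_neg, Complex.re_ofReal_mul, Complex.neg_re,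
    Complex.exp_ofReal_mul_I_re, Complex.exp_ofReal_mul_I_re]
  simp

lemma hasSum_integral_kernel {ν φ : ℝ} (hν0 : 0 < ν) (hν1 : ν < 1) (h₁ : π / 2 < φ) (h₂ : φ < π)
    (x : ℝ) :
    HasSum (fun n : ℕ => (((-x) ^ n / n.factorial : ℝ) : ℂ) *
      ((Real.Gamma (ν * (n + 1)) : ℂ) * Complex.exp ((π * (ν * (n + 1)) : ℝ) * Complex.I)))
      (∫ r in Ioi (0 : ℝ), kernel ν φ x r) := by
  have hc : 0 < -cos φ := neg_cos_pos_of_ray h₁ h₂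
  have key : ∀ n : ℕ, ∀ r : ℝ, 0 < r →
      (((-x) ^ n / n.factorial : ℝ) : ℂ) * (((r ^ (ν * (n + 1) - 1) : ℝ) : ℂ) *
        Complex.exp (-(-Complex.exp (φ * Complex.I) * r)) *
        Complex.exp ((ν * (n + 1) * φ : ℝ) * Complex.I)) =
      ((r ^ (ν - 1) : ℝ) : ℂ) * Complex.exp (-(-Complex.exp (φ * Complex.I) * r)) *
        Complex.exp ((ν * φ : ℝ) * Complex.I) *
        ((-(x * (r ^ ν : ℝ) : ℝ) * Complex.exp ((ν * φ : ℝ) * Complex.I)) ^ n / n.factorial) := by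
    intro n r hr
    have e1 : r ^ (ν * (n + 1) - 1) = r ^ (ν - 1) * (r ^ ν) ^ n := by
      rw [← Real.rpow_natCast (r ^ ν), ← Real.rpow_mul hr.le, ← Real.rpow_add hr]
      congr 1; ring
    have e2 : Complex.exp ((ν * (n + 1) * φ : ℝ) * Complex.I) =
        Complex.exp ((ν * φ : ℝ) * Complex.I) * Complex.exp ((ν * φ : ℝ) * Complex.I) ^ n := by
      rw [← Complex.exp_nat_mul, ← Complex.exp_add]
      congr 1; push_cast; ring
    rw [e1, e2, ← Complex.ofReal_neg, neg_mul_eq_neg_mul, mul_pow]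
    push_cast
    ring
  have hsum : ∀ r : ℝ, HasSum (fun n : ℕ => r ^ (ν - 1) * rexp (-(-cos φ * r)) *
      ((|x| * r ^ ν) ^ n / n.factorial))
      (r ^ (ν - 1) * rexp (-(-cos φ * r)) * rexp (|x| * r ^ ν)) := fun r => by
    have h := NormedSpace.expSeries_div_hasSum_exp (|x| * r ^ ν)
    rw [← Real.exp_eq_exp_ℝ] at h
    exact h.mul_left _
  have hmeas : ∀ n : ℕ, Measurable (fun r : ℝ => (((-x) ^ n / n.factorial : ℝ) : ℂ) *
      (((r ^ (ν * (n + 1) - 1) : ℝ) : ℂ) *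
        Complex.exp (-(-Complex.exp (φ * Complex.I) * r)) *
        Complex.exp ((ν * (n + 1) * φ : ℝ) * Complex.I))) := fun n =>
    ((measurable_rpow_mul_cexp_neg _ _).mul_const _).const_mul _
  have := hasSum_integral_of_dominated_convergence (μ := volume.restrict (Ioi (0 : ℝ)))
    (F := fun (n : ℕ) r => (((-x) ^ n / n.factorial : ℝ) : ℂ) *
      (((r ^ (ν * (n + 1) - 1) : ℝ) : ℂ) *
        Complex.exp (-(-Complex.exp (φ * Complex.I) * r)) *
        Complex.exp ((ν * (n + 1) * φ : ℝ) * Complex.I)))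
    (f := kernel ν φ x)
    (fun n r => r ^ (ν - 1) * rexp (-(-cos φ * r)) * ((|x| * r ^ ν) ^ n / n.factorial))
    (fun n => (hmeas n).aestronglyMeasurable) (fun n => ?_)
    (.of_forall fun r => (hsum r).summable) ?_ ?_
  · simpa only [integral_const_mul, integral_mul_const, fun n : ℕ =>
      integral_rpow_mul_cexp_ray h₁ h₂ (show 0 < ν * ((n : ℝ) + 1) by positivity)] using this
  · filter_upwards [ae_restrict_mem measurableSet_Ioi] with r hr
    have hr' : (0 : ℝ) < r := hr
    rw [key n r hr, norm_mul, norm_mul, norm_rpow_mul_cexp_neg _ _ hr,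
      Complex.norm_exp_ofReal_mul_I, norm_div, norm_pow, norm_mul, Complex.norm_exp_ofReal_mul_I, norm_neg, Complex.norm_real,
      norm_mul, Real.norm_of_nonneg (show 0 ≤ r ^ ν by positivity)]
    simp
  · simp_rw [fun r => (hsum r).tsum_eq]
    exact integrableOn_rpow_mul_exp_neg_mul_exp_rpow hν0 hν1 hc (abs_nonneg x)
  · filter_upwards [ae_restrict_mem measurableSet_Ioi] with r hr
    simp_rw [key _ r hr]
    have h := NormedSpace.expSeries_div_hasSum_exp
      (-(x * (r ^ ν : ℝ) : ℝ) * Complex.exp ((ν * φ : ℝ) * Complex.I))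
    rw [← Complex.exp_eq_exp_ℂ] at h
    exact h.mul_left _

lemma mainardi_eq_integral_kernel {ν φ : ℝ} (hν0 : 0 < ν) (hν1 : ν < 1) (h₁ : π / 2 < φ)
    (h₂ : φ < π) (x : ℝ) :
    mainardi ν x = (∫ r in Ioi (0 : ℝ), kernel ν φ x r).im / π := by
  have h := (Complex.hasSum_im (hasSum_integral_kernel hν0 hν1 h₁ h₂ x)).div_const π
  rw [mainardi, ← h.tsum_eq]
  refine tsum_congr fun n => ?_
  rw [Complex.im_ofReal_mul, Complex.im_ofReal_mul, Complex.exp_ofReal_mul_I_im, mul_div_assoc,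
    Gamma_mul_sin_eq (by positivity), div_mul_eq_div_div, div_eq_mul_inv _ (Real.Gamma _)]
  congr 3
  ring

lemma cos_mul_pos_of_ray {ν φ : ℝ} (hν0 : 0 < ν) (h₁ : π / 2 < φ) (h₃ : ν * φ < π / 2) :
    0 < cos (ν * φ) := by
  have : 0 < ν * φ := mul_pos hν0 (by linarith [pi_pos])
  exact Real.cos_pos_of_mem_Ioo ⟨by linarith [pi_pos], h₃⟩

lemma measurable_kernel (ν φ x : ℝ) : Measurable (kernel ν φ x) := by
  unfold kernel
  refine ((measurable_rpow_mul_cexp_neg _ _).mul_const _).mul ?_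
  fun_prop

lemma norm_kernel_le {ν φ x r : ℝ} (hc : 0 < cos (ν * φ)) (hx : 0 ≤ x) (hr : 0 < r) :
    ‖kernel ν φ x r‖ ≤ r ^ (ν - 1) * rexp (-(-cos φ * r)) := by
  rw [norm_kernel _ _ _ hr]
  refine mul_le_of_le_one_right (by positivity) (Real.exp_le_one_iff.2 ?_)
  have : 0 ≤ x * r ^ ν * cos (ν * φ) := by positivity
  linarith

lemma integrableOn_kernel {ν φ x : ℝ} (hν0 : 0 < ν) (h₁ : π / 2 < φ)
    (h₂ : φ < π) (h₃ : ν * φ < π / 2) (hx : 0 ≤ x) : IntegrableOn (kernel ν φ x) (Ioi 0) := by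
  refine (integrableOn_rpow_mul_exp_neg hν0 (neg_cos_pos_of_ray h₁ h₂)).mono'
    (measurable_kernel ν φ x).aestronglyMeasurable ?_
  filter_upwards [ae_restrict_mem measurableSet_Ioi] with r hr
  exact norm_kernel_le (cos_mul_pos_of_ray hν0 h₁ h₃) hx hr

lemma continuousOn_mainardi {ν φ : ℝ} (hν0 : 0 < ν) (hν1 : ν < 1) (h₁ : π / 2 < φ)
    (h₂ : φ < π) (h₃ : ν * φ < π / 2) : ContinuousOn (mainardi ν) (Ici 0) := by
  have hM : mainardi ν = fun x => (∫ r in Ioi (0 : ℝ), kernel ν φ x r).im / π :=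
    funext (mainardi_eq_integral_kernel hν0 hν1 h₁ h₂)
  rw [hM]
  refine ContinuousOn.div_const (Complex.continuous_im.comp_continuousOn ?_) _
  refine continuousOn_of_dominated
    (fun x _ => (measurable_kernel ν φ x).aestronglyMeasurable) (fun x hx => ?_)
    (integrableOn_rpow_mul_exp_neg hν0 (neg_cos_pos_of_ray h₁ h₂)) (.of_forall fun r => ?_)
  · filter_upwards [ae_restrict_mem measurableSet_Ioi] with r hr
    exact norm_kernel_le (cos_mul_pos_of_ray hν0 h₁ h₃) hx hr
  · unfold kernel
    fun_prop

lemma exists_norm_exp_sub_sum_le (K : ℕ) : ∃ C : ℝ, ∀ z : ℂ, z.re ≤ 0 →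
    ‖Complex.exp z - ∑ m ∈ Finset.range K, z ^ m / m.factorial‖ ≤ C * ‖z‖ ^ K := by
  refine ⟨rexp 1 + (1 + K), fun z hz => ?_⟩
  rcases le_total ‖z‖ 1 with h | h
  · calc _ ≤ ‖z‖ ^ K * rexp ‖z‖ := Complex.norm_exp_sub_sum_le_norm_mul_exp z K
      _ ≤ ‖z‖ ^ K * rexp 1 := by gcongr
      _ = rexp 1 * ‖z‖ ^ K := mul_comm _ _
      _ ≤ _ := by gcongr; linarith [K.cast_nonneg (α := ℝ)]
  · have h1 : ‖Complex.exp z‖ ≤ ‖z‖ ^ K := by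
      rw [Complex.norm_exp]
      exact (Real.exp_le_one_iff.2 hz).trans (one_le_pow₀ h)
    have h2 : ‖∑ m ∈ Finset.range K, z ^ m / m.factorial‖ ≤ K * ‖z‖ ^ K := by
      calc _ ≤ ∑ m ∈ Finset.range K, ‖z‖ ^ K := by
            refine norm_sum_le_of_le _ fun m hm => ?_
            rw [norm_div, norm_pow, Complex.norm_natCast]
            refine (div_le_self (by positivity)
              (by exact_mod_cast m.factorial_pos)).trans ?_
            exact pow_le_pow_right₀ h (Finset.mem_range.1 hm).le
        _ = _ := by simp
    calc _ ≤ ‖z‖ ^ K + K * ‖z‖ ^ K := (norm_sub_le _ _).trans (add_le_add h1 h2)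
      _ = (1 + K) * ‖z‖ ^ K := by ring
      _ ≤ _ := by refine mul_le_mul_of_nonneg_right ?_ (by positivity); linarith [Real.exp_pos 1]

/-- The contribution to `kernel` of the `k`-th Taylor coefficient of `exp σ`. -/
noncomputable def kernelTerm (ν φ x : ℝ) (k : ℕ) (r : ℝ) : ℂ :=
  ((r ^ (ν - 1) : ℝ) : ℂ) * ((Complex.exp (φ * Complex.I) * r) ^ k / k.factorial) *
    Complex.exp ((ν * φ : ℝ) * Complex.I) *
      Complex.exp (-(x * (r ^ ν : ℝ) : ℝ) * Complex.exp ((ν * φ : ℝ) * Complex.I))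

lemma kernelTerm_eq {ν φ x : ℝ} (hν0 : 0 < ν) (k : ℕ) {r : ℝ} (hr : 0 < r) :
    kernelTerm ν φ x k r =
      ((k.factorial * ν : ℝ) : ℂ)⁻¹ * Complex.exp ((k * φ + ν * φ : ℝ) * Complex.I) *
      ((ν * r ^ (ν - 1)) • ((((r ^ ν) ^ ((k / ν + 1) - 1) : ℝ) : ℂ) * Complex.exp
        (-((x * Complex.exp ((ν * φ : ℝ) * Complex.I)) * (r ^ ν : ℝ))))) := by
  have e1 : (r ^ ν) ^ ((k / ν + 1) - 1) = r ^ k := by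
    rw [← Real.rpow_mul hr.le, ← Real.rpow_natCast]
    congr 1
    field_simp
    ring
  have e2 : Complex.exp ((k * φ + ν * φ : ℝ) * Complex.I) =
      Complex.exp (φ * Complex.I) ^ k * Complex.exp ((ν * φ : ℝ) * Complex.I) := by
    rw [← Complex.exp_nat_mul, ← Complex.exp_add]
    congr 1; push_cast; ring
  have e3 : (-(x * (r ^ ν : ℝ) : ℝ) * Complex.exp ((ν * φ : ℝ) * Complex.I)) =
      -((x * Complex.exp ((ν * φ : ℝ) * Complex.I)) * (r ^ ν : ℝ)) := by
    push_cast; ring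
  have hν : (ν : ℂ) ≠ 0 := by exact_mod_cast hν0.ne'
  rw [kernelTerm, e1, e2, e3, Complex.real_smul, mul_pow]
  push_cast
  field_simp

lemma re_mul_exp_pos {ν φ x : ℝ} (hc : 0 < cos (ν * φ)) (hx : 0 < x) :
    0 < ((x : ℂ) * Complex.exp ((ν * φ : ℝ) * Complex.I)).re := by
  rw [Complex.re_ofReal_mul, Complex.exp_ofReal_mul_I_re]
  positivity

lemma integrableOn_kernelTerm {ν φ x : ℝ} (hν0 : 0 < ν) (hc : 0 < cos (ν * φ)) (hx : 0 < x)
    (k : ℕ) : IntegrableOn (kernelTerm ν φ x k) (Ioi 0) := by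
  have ha : 0 < k / ν + 1 := by positivity
  have h := (integrableOn_Ioi_comp_rpow_iff _ hν0.ne').2
    (integrableOn_rpow_mul_cexp_neg ha (re_mul_exp_pos hc hx))
  rw [abs_of_pos hν0] at h
  exact IntegrableOn.congr_fun (h.const_mul _) (fun r hr => (kernelTerm_eq hν0 k hr).symm)
    measurableSet_Ioi

lemma im_integral_kernelTerm {ν φ x : ℝ} (hν0 : 0 < ν) (h₁ : π / 2 < φ)
    (h₃ : ν * φ < π / 2) (hx : 0 < x) (k : ℕ) :
    (∫ r in Ioi (0 : ℝ), kernelTerm ν φ x k r).im = 0 := by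
  have ha : 0 < k / ν + 1 := by positivity
  have hφ : 0 < ν * φ := mul_pos hν0 (by linarith [pi_pos])
  rw [setIntegral_congr_fun measurableSet_Ioi fun r hr => kernelTerm_eq hν0 k hr,
    integral_const_mul, integral_comp_rpow_Ioi_of_pos (g := fun u =>
      ((u ^ ((k / ν + 1) - 1) : ℝ) : ℂ) * Complex.exp
        (-((x * Complex.exp ((ν * φ : ℝ) * Complex.I)) * u))) hν0,
    integral_rpow_mul_cexp_neg ha (re_mul_exp_pos (cos_mul_pos_of_ray hν0 h₁ h₃) hx),
    ← Complex.ofReal_neg, mul_exp_mul_I_cpow hx (by linarith [pi_pos]) (by linarith [pi_pos])]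
  have e : Complex.exp ((k * φ + ν * φ : ℝ) * Complex.I) *
      Complex.exp ((-(k / ν + 1) * (ν * φ) : ℝ) * Complex.I) = 1 := by
    rw [← Complex.exp_add, Complex.exp_eq_one_iff]
    refine ⟨0, ?_⟩
    have : -(k / ν + 1) * (ν * φ) = -(k * φ + ν * φ) := by field_simp
    rw [this]
    push_cast
    ring
  have hreal : ∀ A X G E₁ E₂ : ℂ, E₁ * E₂ = 1 → A * E₁ * (X * E₂ * G) = A * X * G :=
    fun A X G E₁ E₂ h => by linear_combination A * X * G * h
  rw [hreal _ _ _ _ _ e, ← Complex.ofReal_inv, ← Complex.ofReal_mul, ← Complex.ofReal_mul,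
    Complex.ofReal_im]

lemma exists_abs_mainardi_le {ν φ : ℝ} (hν0 : 0 < ν) (hν1 : ν < 1) (h₁ : π / 2 < φ)
    (h₂ : φ < π) (h₃ : ν * φ < π / 2) (K : ℕ) :
    ∃ C : ℝ, ∀ x : ℝ, 0 < x → |mainardi ν x| ≤ C * x ^ (-(K + ν) / ν) := by
  obtain ⟨C, hC⟩ := exists_norm_exp_sub_sum_le K
  have hcφ := neg_cos_pos_of_ray h₁ h₂
  have hc := cos_mul_pos_of_ray hν0 h₁ h₃
  refine ⟨C * (cos (ν * φ) ^ (-(K + ν) / ν) * (1 / ν) * Real.Gamma ((K + ν) / ν)) / π,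
    fun x hx => ?_⟩
  have hT : ∀ k ∈ Finset.range K,
      Integrable (kernelTerm ν φ x k) (volume.restrict (Ioi 0)) :=
    fun k _ => integrableOn_kernelTerm hν0 hc hx k
  have him : (∫ r in Ioi (0 : ℝ), kernel ν φ x r).im =
      (∫ r in Ioi (0 : ℝ), (kernel ν φ x r - ∑ k ∈ Finset.range K, kernelTerm ν φ x k r)).im := by
    rw [integral_sub (integrableOn_kernel hν0 h₁ h₂ h₃ hx.le) (integrable_finsetSum _ hT),
      integral_finsetSum _ hT, Complex.sub_im, Complex.im_sum,
      Finset.sum_eq_zero fun k _ => im_integral_kernelTerm hν0 h₁ h₃ hx k, sub_zero]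
  have hbound : ∀ r ∈ Ioi (0 : ℝ),
      ‖kernel ν φ x r - ∑ k ∈ Finset.range K, kernelTerm ν φ x k r‖ ≤
        C * (r ^ (K + ν - 1) * rexp (-(x * cos (ν * φ)) * r ^ ν)) := by
    intro r hr
    have hr' : (0 : ℝ) < r := hr
    have e : kernel ν φ x r - ∑ k ∈ Finset.range K, kernelTerm ν φ x k r =
        ((r ^ (ν - 1) : ℝ) : ℂ) * (Complex.exp (Complex.exp (φ * Complex.I) * r) -
          ∑ k ∈ Finset.range K, (Complex.exp (φ * Complex.I) * r) ^ k / k.factorial) *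
        Complex.exp ((ν * φ : ℝ) * Complex.I) *
        Complex.exp (-(x * (r ^ ν : ℝ) : ℝ) * Complex.exp ((ν * φ : ℝ) * Complex.I)) := by
      simp only [kernel, kernelTerm, ← Finset.sum_mul, ← Finset.mul_sum, neg_mul, neg_neg]
      ring
    have hre : (Complex.exp (φ * Complex.I) * r).re ≤ 0 := by
      rw [Complex.re_mul_ofReal, Complex.exp_ofReal_mul_I_re]
      exact mul_nonpos_of_nonpos_of_nonneg (by linarith) hr'.le
    have hrem := hC _ hre
    rw [norm_mul (Complex.exp _) (r : ℂ), Complex.norm_exp_ofReal_mul_I, one_mul,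
      Complex.norm_real, Real.norm_of_nonneg hr'.le] at hrem
    rw [e, norm_mul, norm_mul, norm_mul, Complex.norm_exp_ofReal_mul_I, mul_one, Complex.norm_exp,
      Complex.norm_real, Real.norm_of_nonneg (by positivity), ← Complex.ofReal_neg,
      Complex.re_ofReal_mul, Complex.exp_ofReal_mul_I_re]
    calc _ ≤ r ^ (ν - 1) * (C * r ^ K) * rexp (-(x * r ^ ν) * cos (ν * φ)) := by gcongr
      _ = _ := by
        rw [show (K : ℝ) + ν - 1 = (ν - 1) + K by ring, Real.rpow_add_natCast hr'.ne']
        ring_nf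
  have hint := integrableOn_rpow_mul_exp_neg_mul_rpow (p := ν) (s := K + ν - 1)
    (b := x * cos (ν * φ)) (by linarith [K.cast_nonneg (α := ℝ)]) hν0 (by positivity)
  have hval := integral_rpow_mul_exp_neg_mul_rpow (p := ν) (q := K + ν - 1)
    (b := x * cos (ν * φ)) hν0 (by linarith [K.cast_nonneg (α := ℝ)]) (by positivity)
  rw [sub_add_cancel] at hval
  rw [mainardi_eq_integral_kernel hν0 hν1 h₁ h₂, him, abs_div, abs_of_pos pi_pos,
    div_mul_eq_mul_div]
  refine div_le_div_of_nonneg_right ?_ pi_pos.le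
  calc _ ≤ ‖∫ r in Ioi (0 : ℝ), (kernel ν φ x r - ∑ k ∈ Finset.range K, kernelTerm ν φ x k r)‖ :=
        Complex.abs_im_le_norm _
    _ ≤ ∫ r in Ioi (0 : ℝ), C * (r ^ (K + ν - 1) * rexp (-(x * cos (ν * φ)) * r ^ ν)) :=
        norm_integral_le_of_norm_le (hint.const_mul C)
          ((ae_restrict_mem measurableSet_Ioi).mono hbound)
    _ = _ := by
        rw [integral_const_mul, hval, Real.mul_rpow hx.le hc.le]
        ring

lemma mul_kernel_eq (ν φ s x r : ℝ) :
    ((x ^ (s - 1) : ℝ) : ℂ) * kernel ν φ x r =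
      (((r ^ (ν - 1) : ℝ) : ℂ) * Complex.exp (-(-Complex.exp (φ * Complex.I) * r)) *
        Complex.exp ((ν * φ : ℝ) * Complex.I)) * (((x ^ (s - 1) : ℝ) : ℂ) *
      Complex.exp (-((((r ^ ν : ℝ) : ℂ) * Complex.exp ((ν * φ : ℝ) * Complex.I)) * x))) := by
  rw [kernel, show (-(x * (r ^ ν : ℝ) : ℝ) * Complex.exp ((ν * φ : ℝ) * Complex.I)) =
      -((((r ^ ν : ℝ) : ℂ) * Complex.exp ((ν * φ : ℝ) * Complex.I)) * x) by push_cast; ring]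
  ring

lemma integral_mul_kernel {ν φ s r : ℝ} (hν0 : 0 < ν) (h₁ : π / 2 < φ)
    (h₃ : ν * φ < π / 2) (hs : 0 < s) (hr : 0 < r) :
    ∫ x in Ioi (0 : ℝ), ((x ^ (s - 1) : ℝ) : ℂ) * kernel ν φ x r =
      (((r ^ (ν * (1 - s) - 1) : ℝ) : ℂ) *
        Complex.exp (-(-Complex.exp (φ * Complex.I) * r))) *
      (Complex.exp ((ν * (1 - s) * φ : ℝ) * Complex.I) * (Real.Gamma s : ℂ)) := by
  have hφ : 0 < ν * φ := mul_pos hν0 (by linarith [pi_pos])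
  have hrν : 0 < r ^ ν := by positivity
  simp_rw [mul_kernel_eq]
  rw [integral_const_mul, integral_rpow_mul_cexp_neg hs
    (re_mul_exp_pos (cos_mul_pos_of_ray hν0 h₁ h₃) hrν), ← Complex.ofReal_neg,
    mul_exp_mul_I_cpow hrν (by linarith [pi_pos]) (by linarith [pi_pos]),
    show r ^ (ν * (1 - s) - 1) = r ^ (ν - 1) * (r ^ ν) ^ (-s) by
      rw [← Real.rpow_mul hr.le, ← Real.rpow_add hr]; congr 1; ring,
    show Complex.exp ((ν * (1 - s) * φ : ℝ) * Complex.I) =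
      Complex.exp ((ν * φ : ℝ) * Complex.I) * Complex.exp ((-s * (ν * φ) : ℝ) * Complex.I) by
      rw [← Complex.exp_add]; congr 1; push_cast; ring]
  push_cast
  ring

lemma integrable_mul_kernel {ν φ s : ℝ} (hν0 : 0 < ν) (h₁ : π / 2 < φ)
    (h₂ : φ < π) (h₃ : ν * φ < π / 2) (hs0 : 0 < s) (hs1 : s < 1) :
    Integrable (Function.uncurry fun x r : ℝ => ((x ^ (s - 1) : ℝ) : ℂ) * kernel ν φ x r)
      ((volume.restrict (Ioi 0)).prod (volume.restrict (Ioi 0))) := by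
  have hc := cos_mul_pos_of_ray hν0 h₁ h₃
  have hmeas : Measurable
      (Function.uncurry fun x r : ℝ => ((x ^ (s - 1) : ℝ) : ℂ) * kernel ν φ x r) := by
    unfold kernel Function.uncurry
    fun_prop
  refine (integrable_prod_iff' hmeas.aestronglyMeasurable).2 ⟨?_, ?_⟩
  · filter_upwards [ae_restrict_mem measurableSet_Ioi] with r hr
    have hr' : (0 : ℝ) < r := hr
    simp only [Function.uncurry_apply_pair, mul_kernel_eq]
    exact (integrableOn_rpow_mul_cexp_neg hs0 (re_mul_exp_pos hc (by positivity))).const_mul _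
  · refine IntegrableOn.congr_fun ((integrableOn_rpow_mul_exp_neg (a := ν * (1 - s))
      (mul_pos hν0 (by linarith)) (neg_cos_pos_of_ray h₁ h₂)).mul_const
      ((1 / cos (ν * φ)) ^ s * Real.Gamma s)) (fun r hr => ?_) measurableSet_Ioi
    have hr' : (0 : ℝ) < r := hr
    have hn : ∀ x ∈ Ioi (0 : ℝ), ‖((x ^ (s - 1) : ℝ) : ℂ) * kernel ν φ x r‖ =
        r ^ (ν - 1) * rexp (-(-cos φ * r)) *
          (x ^ (s - 1) * rexp (-(r ^ ν * cos (ν * φ) * x))) := fun x hx => by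
      rw [norm_mul, norm_kernel _ _ _ hr', Complex.norm_real,
        Real.norm_of_nonneg (Real.rpow_nonneg (le_of_lt hx) _),
        show x * r ^ ν * cos (ν * φ) = r ^ ν * cos (ν * φ) * x by ring]
      ring
    simp only [Function.uncurry_apply_pair]
    rw [setIntegral_congr_fun measurableSet_Ioi hn, integral_const_mul,
      Real.integral_rpow_mul_exp_neg_mul_Ioi hs0 (by positivity), one_div, one_div,
      mul_inv, Real.mul_rpow (by positivity) (by positivity),
      show r ^ (ν * (1 - s) - 1) = r ^ (ν - 1) * (r ^ ν)⁻¹ ^ s by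
        rw [Real.inv_rpow (by positivity), ← Real.rpow_neg (by positivity), ← Real.rpow_mul hr'.le,
          ← Real.rpow_add hr']; congr 1; ring]
    ring

lemma integral_rpow_mul_mainardi_of_lt_one {ν φ s : ℝ} (hν0 : 0 < ν) (hν1 : ν < 1)
    (h₁ : π / 2 < φ) (h₂ : φ < π) (h₃ : ν * φ < π / 2) (hs0 : 0 < s) (hs1 : s < 1) :
    ∫ x in Ioi (0 : ℝ), x ^ (s - 1) * mainardi ν x =
      Real.Gamma s * (Real.Gamma (1 - ν + ν * s))⁻¹ := by
  have ha : 0 < ν * (1 - s) := mul_pos hν0 (by linarith)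
  have hint := integrable_mul_kernel hν0 h₁ h₂ h₃ hs0 hs1
  have hval : ∫ x in Ioi (0 : ℝ), ∫ r in Ioi (0 : ℝ), ((x ^ (s - 1) : ℝ) : ℂ) * kernel ν φ x r =
      ((Real.Gamma (ν * (1 - s)) * Real.Gamma s : ℝ) : ℂ) *
        Complex.exp ((π * (ν * (1 - s)) : ℝ) * Complex.I) := by
    rw [integral_integral_swap hint, setIntegral_congr_fun measurableSet_Ioi fun r hr =>
      integral_mul_kernel hν0 h₁ h₃ hs0 hr, integral_mul_const, ← mul_assoc,
      integral_rpow_mul_cexp_ray h₁ h₂ ha]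
    push_cast
    ring
  have him : ∀ x : ℝ, x ^ (s - 1) * mainardi ν x =
      (∫ r in Ioi (0 : ℝ), ((x ^ (s - 1) : ℝ) : ℂ) * kernel ν φ x r).im / π := fun x => by
    rw [mainardi_eq_integral_kernel hν0 hν1 h₁ h₂, integral_const_mul, Complex.im_ofReal_mul,
      mul_div_assoc]
  simp_rw [him]
  have h := integral_im hint.integral_prod_left
  simp only [RCLike.im_eq_complex_im, Function.uncurry_apply_pair] at h
  rw [integral_div, h, hval, Complex.im_ofReal_mul, Complex.exp_ofReal_mul_I_im, mul_right_comm,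
    mul_comm, mul_div_assoc, Gamma_mul_sin_eq ha]
  ring_nf

lemma exists_ray_angle {ν : ℝ} (hν0 : 0 < ν) (hν1 : ν < 1) :
    ∃ φ : ℝ, π / 2 < φ ∧ φ < π ∧ ν * φ < π / 2 := by
  have h : π / 2 < min π (π / 2 / ν) :=
    lt_min (by linarith [pi_pos]) ((lt_div_iff₀ hν0).2 (by nlinarith [pi_pos]))
  obtain ⟨φ, h₁, h₂⟩ := exists_between h
  exact ⟨φ, h₁, h₂.trans_le (min_le_left _ _),
    by rw [mul_comm]; exact (lt_div_iff₀ hν0).1 (h₂.trans_le (min_le_right _ _))⟩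

lemma locallyIntegrableOn_mainardi {ν : ℝ} (hν0 : 0 < ν) (hν1 : ν < 1) :
    LocallyIntegrableOn (fun x => (mainardi ν x : ℂ)) (Ioi 0) := by
  obtain ⟨φ, h₁, h₂, h₃⟩ := exists_ray_angle hν0 hν1
  exact (Complex.continuous_ofReal.comp_continuousOn
    ((continuousOn_mainardi hν0 hν1 h₁ h₂ h₃).mono Ioi_subset_Ici_self)).locallyIntegrableOn
    measurableSet_Ioi

lemma mainardi_isBigO_atTop {ν : ℝ} (hν0 : 0 < ν) (hν1 : ν < 1) (a : ℝ) :
    (fun x => (mainardi ν x : ℂ)) =O[Filter.atTop] fun x : ℝ => x ^ (-a) := by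
  obtain ⟨φ, h₁, h₂, h₃⟩ := exists_ray_angle hν0 hν1
  obtain ⟨K, hK⟩ := exists_nat_ge (a * ν)
  obtain ⟨C, hC⟩ := exists_abs_mainardi_le hν0 hν1 h₁ h₂ h₃ K
  refine Asymptotics.IsBigO.of_bound |C| ?_
  filter_upwards [Filter.eventually_ge_atTop 1] with x hx
  have hx0 : 0 < x := by linarith
  rw [Complex.norm_real, Real.norm_eq_abs, Real.norm_of_nonneg (by positivity)]
  refine (hC x hx0).trans ?_
  have hexp : -(K + ν) / ν ≤ -a := by
    rw [div_le_iff₀ hν0]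
    linarith
  exact mul_le_mul (le_abs_self C) (Real.rpow_le_rpow_of_exponent_le hx hexp) (by positivity)
    (abs_nonneg C)

lemma mainardi_isBigO_zero {ν : ℝ} (hν0 : 0 < ν) (hν1 : ν < 1) :
    (fun x => (mainardi ν x : ℂ)) =O[nhdsWithin 0 (Ioi 0)] fun x : ℝ => x ^ (-(0 : ℝ)) := by
  obtain ⟨φ, h₁, h₂, h₃⟩ := exists_ray_angle hν0 hν1
  have h : Filter.Tendsto (fun x => (mainardi ν x : ℂ)) (nhdsWithin 0 (Ioi 0))
      (nhds (mainardi ν 0 : ℂ)) :=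
    (Complex.continuous_ofReal.tendsto _).comp
      (((continuousOn_mainardi hν0 hν1 h₁ h₂ h₃) 0 self_mem_Ici).mono_left
        (nhdsWithin_mono _ Ioi_subset_Ici_self))
  simpa using h.isBigO_one ℝ

lemma mellinConvergent_mainardi {ν : ℝ} (hν0 : 0 < ν) (hν1 : ν < 1) {s : ℂ} (hs : 0 < s.re) :
    MellinConvergent (fun x => (mainardi ν x : ℂ)) s :=
  mellinConvergent_of_isBigO_rpow (locallyIntegrableOn_mainardi hν0 hν1)
    (mainardi_isBigO_atTop hν0 hν1 (s.re + 1)) (by linarith) (mainardi_isBigO_zero hν0 hν1) hs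

lemma cpow_smul_mainardi {ν s x : ℝ} (hx : 0 < x) :
    (x : ℂ) ^ ((s : ℂ) - 1) • (mainardi ν x : ℂ) = ((x ^ (s - 1) * mainardi ν x : ℝ) : ℂ) := by
  rw [Complex.ofReal_mul, Complex.ofReal_cpow hx.le]
  simp

lemma mellin_mainardi_ofReal (ν s : ℝ) :
    mellin (fun x => (mainardi ν x : ℂ)) s =
      ((∫ x in Ioi (0 : ℝ), x ^ (s - 1) * mainardi ν x : ℝ) : ℂ) := by
  rw [mellin, ← integral_complex_ofReal]
  exact setIntegral_congr_fun measurableSet_Ioi fun x hx => cpow_smul_mainardi hx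

lemma mellin_mainardi_eq {ν : ℝ} (hν0 : 0 < ν) (hν1 : ν < 1) {s : ℂ} (hs : 0 < s.re) :
    mellin (fun x => (mainardi ν x : ℂ)) s =
      Complex.Gamma s * (Complex.Gamma (1 - ν + ν * s))⁻¹ := by
  obtain ⟨φ, h₁, h₂, h₃⟩ := exists_ray_angle hν0 hν1
  have hopen : IsOpen {w : ℂ | 0 < w.re} := isOpen_lt continuous_const Complex.continuous_re
  have hF : AnalyticOnNhd ℂ (mellin fun x => (mainardi ν x : ℂ)) {w : ℂ | 0 < w.re} :=
    DifferentiableOn.analyticOnNhd (fun w hw =>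
      (mellin_differentiableAt_of_isBigO_rpow (locallyIntegrableOn_mainardi hν0 hν1)
        (mainardi_isBigO_atTop hν0 hν1 (w.re + 1)) (by linarith)
        (mainardi_isBigO_zero hν0 hν1) hw).differentiableWithinAt) hopen
  have hG : AnalyticOnNhd ℂ (fun s : ℂ => Complex.Gamma s * (Complex.Gamma (1 - ν + ν * s))⁻¹)
      {w : ℂ | 0 < w.re} := by
    refine DifferentiableOn.analyticOnNhd (fun w hw => DifferentiableAt.differentiableWithinAt ?_)
      hopen
    refine (Complex.differentiableAt_Gamma w fun m hm => ?_).mul ?_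
    · rw [mem_ofPred_eq, hm] at hw
      simp only [Complex.neg_re, Complex.natCast_re] at hw
      linarith [m.cast_nonneg (α := ℝ)]
    · exact (Complex.differentiable_one_div_Gamma _).comp w (f := fun s : ℂ => 1 - ν + ν * s)
        (by fun_prop)
  refine hF.eqOn_of_preconnected_of_frequently_eq hG
    (convex_halfSpace_re_gt 0).isPreconnected (z₀ := ((1 / 2 : ℝ) : ℂ))
    (by rw [mem_ofPred_eq, Complex.ofReal_re]; norm_num) ?_ hs
  refine Filter.Tendsto.frequently (f := fun r : ℝ => (r : ℂ))
    (l₁ := nhdsWithin (1 / 2) {1 / 2}ᶜ) ?_ (Filter.Eventually.frequently ?_)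
  · refine tendsto_nhdsWithin_iff.2 ⟨?_, ?_⟩
    · exact (Complex.continuous_ofReal.tendsto _).mono_left nhdsWithin_le_nhds
    · filter_upwards [self_mem_nhdsWithin] with r hr
      exact fun h => hr (Complex.ofReal_injective h)
  · filter_upwards [mem_nhdsWithin_of_mem_nhds (Ioo_mem_nhds (a := (0 : ℝ)) (b := 1)
      (by norm_num) (by norm_num))] with r hr
    rw [mellin_mainardi_ofReal,
      integral_rpow_mul_mainardi_of_lt_one hν0 hν1 h₁ h₂ h₃ hr.1 hr.2, Complex.ofReal_mul,
      Complex.ofReal_inv, ← Complex.Gamma_ofReal, ← Complex.Gamma_ofReal]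
    push_cast
    rfl

end Mainardi

theorem mellin_mainardi (ν : ℝ) (hν0 : 0 < ν) (hν1 : ν < 1) (s : ℝ) (hs : 0 < s) :
    IntegrableOn (fun x : ℝ => x ^ (s - 1) * mainardi ν x) (Ioi 0) ∧
    ∫ x in Ioi (0 : ℝ), x ^ (s - 1) * mainardi ν x =
      Real.Gamma s / Real.Gamma (1 - ν + ν * s) := by
  have hs' : 0 < (s : ℂ).re := by simpa using hs
  constructor
  · have h : IntegrableOn (fun x : ℝ => ((x ^ (s - 1) * mainardi ν x : ℝ) : ℂ)) (Ioi 0) :=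
      (Mainardi.mellinConvergent_mainardi hν0 hν1 hs').congr_fun
        (fun x hx => Mainardi.cpow_smul_mainardi hx) measurableSet_Ioi
    simpa [IntegrableOn] using Integrable.re h
  · have h := Mainardi.mellin_mainardi_eq hν0 hν1 hs'
    rw [Mainardi.mellin_mainardi_ofReal] at h
    apply Complex.ofReal_injective
    rw [h, Complex.ofReal_div, ← Complex.Gamma_ofReal, ← Complex.Gamma_ofReal, div_eq_mul_inv]
    push_cast
    rfl
end

section
/- For every 0 < ν < 1, the Mainardi function M_ν is integrable on (0,∞) and satisfies ∫₀^∞ M_ν(u) du = 1. -/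
open Real MeasureTheory Set

theorem integrableOn_rpow_mul_exp_neg_mul {s b : ℝ} (hs : -1 < s) (hb : 0 < b) :
    IntegrableOn (fun t : ℝ => t ^ s * exp (-(b * t))) (Ioi 0) := by
  simpa using integrableOn_rpow_mul_exp_neg_mul_rpow hs one_pos hb

theorem norm_rpow_mul_cexp_neg_mul {s t : ℝ} (ht : 0 ≤ t) (z : ℂ) :
    ‖((t ^ s : ℝ) : ℂ) * Complex.exp (-(z * t))‖ = t ^ s * exp (-(z.re * t)) := by
  rw [norm_mul, Complex.norm_real, Complex.norm_exp, norm_of_nonneg (rpow_nonneg ht _)]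
  simp

theorem measurable_rpow_mul_cexp_neg_mul (s : ℝ) (z : ℂ) :
    Measurable fun t : ℝ => ((t ^ s : ℝ) : ℂ) * Complex.exp (-(z * t)) := by
  fun_prop

theorem integrableOn_rpow_mul_cexp_neg_mul {s : ℝ} {z : ℂ} (hs : -1 < s) (hz : 0 < z.re) :
    IntegrableOn (fun t : ℝ => ((t ^ s : ℝ) : ℂ) * Complex.exp (-(z * t))) (Ioi 0) := by
  refine (integrableOn_rpow_mul_exp_neg_mul hs hz).mono'
    (measurable_rpow_mul_cexp_neg_mul s z).aestronglyMeasurable ?_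
  filter_upwards [ae_restrict_mem measurableSet_Ioi] with t ht
  exact (norm_rpow_mul_cexp_neg_mul (le_of_lt ht) z).le

theorem differentiableAt_integral_rpow_mul_cexp_neg_mul {s : ℝ} {z : ℂ} (hs : -1 < s)
    (hz : 0 < z.re) :
    DifferentiableAt ℂ
      (fun z : ℂ => ∫ t in Ioi (0 : ℝ), ((t ^ s : ℝ) : ℂ) * Complex.exp (-(z * t))) z := by
  have hU : {w : ℂ | z.re / 2 < w.re} ∈ nhds z :=
    (isOpen_lt continuous_const Complex.continuous_re).mem_nhds (by simpa using hz)
  refine (hasDerivAt_integral_of_dominated_loc_of_deriv_le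
    (F' := fun w t => ((t ^ s : ℝ) : ℂ) * (Complex.exp (-(w * t)) * (-t)))
    (bound := fun t : ℝ => t ^ (s + 1) * exp (-(z.re / 2 * t))) hU
    (.of_forall fun w => (measurable_rpow_mul_cexp_neg_mul s w).aestronglyMeasurable)
    (integrableOn_rpow_mul_cexp_neg_mul hs hz)
    (Measurable.aestronglyMeasurable (by fun_prop)) ?_
    (integrableOn_rpow_mul_exp_neg_mul (by linarith) (by linarith)) ?_).2.differentiableAt
  · filter_upwards [ae_restrict_mem measurableSet_Ioi] with t ht w hw
    have ht : 0 < t := ht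
    rw [← mul_assoc, norm_mul, norm_rpow_mul_cexp_neg_mul ht.le, norm_neg, Complex.norm_real,
      norm_of_nonneg ht.le, rpow_add_one ht.ne', mul_right_comm]
    have hw : z.re / 2 < w.re := hw
    gcongr
  · filter_upwards with t w _
    refine HasDerivAt.const_mul _ (HasDerivAt.cexp ?_)
    simpa using ((hasDerivAt_id' w).mul_const (t : ℂ)).fun_neg

theorem integral_rpow_mul_cexp_neg_mul {a : ℝ} {z : ℂ} (ha : 0 < a) (hz : 0 < z.re) :
    ∫ t in Ioi (0 : ℝ), ((t ^ (a - 1) : ℝ) : ℂ) * Complex.exp (-(z * t)) =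
      z ^ (-a : ℂ) * (Gamma a : ℂ) := by
  have hU : IsOpen {w : ℂ | 0 < w.re} := isOpen_lt continuous_const Complex.continuous_re
  have h := AnalyticOnNhd.eqOn_of_preconnected_of_frequently_eq (z₀ := 1)
    (f := fun z : ℂ => ∫ t in Ioi (0 : ℝ), ((t ^ (a - 1) : ℝ) : ℂ) * Complex.exp (-(z * t)))
    (g := fun z : ℂ => z ^ (-a : ℂ) * (Gamma a : ℂ))
    (DifferentiableOn.analyticOnNhd (fun w hw =>
      (differentiableAt_integral_rpow_mul_cexp_neg_mul (by linarith) hw).differentiableWithinAt) hU)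
    (DifferentiableOn.analyticOnNhd (fun w hw => DifferentiableAt.differentiableWithinAt
      (((differentiableAt_id).cpow_const (Or.inl hw)).mul_const _)) hU)
    (convex_halfSpace_re_gt 0).isPreconnected
    (show (0 : ℝ) < (1 : ℂ).re by simp) ?_
  · exact h hz
  have hreal : ∀ r : ℝ, 0 < r →
      ∫ t in Ioi (0 : ℝ), ((t ^ (a - 1) : ℝ) : ℂ) * Complex.exp (-((r : ℂ) * t)) =
        (r : ℂ) ^ (-a : ℂ) * (Gamma a : ℂ) := by
    intro r hr
    have := Real.integral_rpow_mul_exp_neg_mul_Ioi ha hr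
    rw [one_div, inv_rpow hr.le, ← rpow_neg hr.le] at this
    have h2 := congrArg (fun x : ℝ => (x : ℂ)) this
    rw [← integral_complex_ofReal] at h2
    push_cast [Complex.ofReal_cpow hr.le] at h2 ⊢
    exact h2
  have htend : Filter.Tendsto (fun n : ℕ => ((1 + 1 / ((n : ℝ) + 1) : ℝ) : ℂ)) Filter.atTop
      (nhdsWithin 1 {1}ᶜ) := by
    refine tendsto_nhdsWithin_iff.2 ⟨?_, .of_forall fun n => ?_⟩
    · have := (tendsto_one_div_add_atTop_nhds_zero_nat (𝕜 := ℝ)).const_add 1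
      rw [add_zero] at this
      exact (Complex.continuous_ofReal.tendsto' 1 1 Complex.ofReal_one).comp this
    · have : (0 : ℝ) < 1 / ((n : ℝ) + 1) := by positivity
      simp only [mem_compl_iff, mem_singleton_iff, Complex.ofReal_eq_one]
      linarith
  exact htend.frequently (.of_forall fun n => hreal _ (by positivity))

theorem ofReal_mul_cexp_cpow {ρ θ : ℝ} (hρ : 0 < ρ) (h1 : -π < θ) (h2 : θ ≤ π) (a : ℝ) :
    ((ρ : ℂ) * Complex.exp (θ * Complex.I)) ^ (a : ℂ) =
      ((ρ ^ a : ℝ) : ℂ) * Complex.exp ((a * θ : ℝ) * Complex.I) := by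
  rw [Complex.cpow_def_of_ne_zero (mul_ne_zero (by exact_mod_cast hρ.ne') (Complex.exp_ne_zero _)),
    Complex.log_ofReal_mul hρ (Complex.exp_ne_zero _), Complex.log_exp (by simpa) (by simpa),
    add_mul, Complex.exp_add, rpow_def_of_pos hρ]
  push_cast
  ring_nf

/-- The Gamma integral along a rotated ray. -/
theorem integral_rpow_mul_cexp_neg_polar_mul {a ρ θ : ℝ} (ha : 0 < a) (hρ : 0 < ρ)
    (hθ : θ ∈ Ioo (-(π / 2)) (π / 2)) :
    ∫ t in Ioi (0 : ℝ), ((t ^ (a - 1) : ℝ) : ℂ) *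
        Complex.exp (-(ρ * Complex.exp (θ * Complex.I) * t)) =
      ((ρ ^ (-a) * Gamma a : ℝ) : ℂ) * Complex.exp ((-a * θ : ℝ) * Complex.I) := by
  have hπ := pi_pos
  rw [integral_rpow_mul_cexp_neg_mul ha, ← Complex.ofReal_neg,
    ofReal_mul_cexp_cpow hρ (by linarith [hθ.1]) (by linarith [hθ.2])]
  · push_cast
    ring
  · rw [Complex.re_ofReal_mul, Complex.exp_ofReal_mul_I_re]
    exact mul_pos hρ (cos_pos_of_mem_Ioo hθ)

theorem norm_cexp_sub_one_le_of_re_nonpos {z : ℂ} (hz : z.re ≤ 0) :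
    ‖Complex.exp z - 1‖ ≤ 2 * ‖z‖ := by
  rcases le_total ‖z‖ 1 with h | h
  · exact Complex.norm_exp_sub_one_le h
  · have : ‖Complex.exp z‖ ≤ 1 := by rw [Complex.norm_exp]; exact exp_le_one_iff.2 hz
    calc ‖Complex.exp z - 1‖ ≤ ‖Complex.exp z‖ + ‖(1 : ℂ)‖ := norm_sub_le _ _
      _ ≤ 2 * ‖z‖ := by rw [norm_one]; linarith

theorem integrableOn_rpow_mul_exp_neg_mul_mul_exp_mul_rpow {s b p : ℝ} (hs : -1 < s) (hb : 0 < b)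
    (hp0 : 0 < p) (hp1 : p < 1) (x : ℝ) :
    IntegrableOn (fun t : ℝ => t ^ s * exp (-(b * t)) * exp (x * t ^ p)) (Ioi 0) := by
  obtain ⟨T, hT⟩ := Filter.eventually_atTop.1
    ((tendsto_rpow_atTop (sub_pos.2 hp1)).eventually_ge_atTop (2 * |x| / b))
  set S := max T 1
  have hS : 0 < S := lt_max_of_lt_right one_pos
  have key : ∀ t : ℝ, 0 < t → x * t ^ p ≤ b / 2 * t + |x| * S ^ p := by
    intro t ht
    have hxt : x * t ^ p ≤ |x| * t ^ p := by gcongr; exact le_abs_self x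
    rcases le_total S t with h | h
    · have h1 := hT t ((le_max_left _ _).trans h)
      rw [div_le_iff₀ hb] at h1
      have h2 : t ^ (1 - p) * t ^ p = t := by
        rw [← rpow_add ht, sub_add_cancel, rpow_one]
      have h3 : 2 * |x| * t ^ p ≤ t ^ (1 - p) * b * t ^ p := by gcongr
      have h4 : 0 ≤ |x| * S ^ p := by positivity
      nlinarith
    · have h1 : |x| * t ^ p ≤ |x| * S ^ p := by gcongr
      have h2 : 0 ≤ b / 2 * t := by positivity
      linarith
  refine ((integrableOn_rpow_mul_exp_neg_mul hs (half_pos hb)).const_mul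
    (exp (|x| * S ^ p))).mono' (Measurable.aestronglyMeasurable (by fun_prop)) ?_
  filter_upwards [ae_restrict_mem measurableSet_Ioi] with t ht
  have ht : 0 < t := ht
  rw [norm_of_nonneg (by positivity), mul_assoc, ← exp_add, mul_left_comm, ← exp_add]
  refine mul_le_mul_of_nonneg_left (exp_le_exp.2 ?_) (by positivity)
  linarith [key t ht]

/-- The angle `φ` with `φ * (1 + ν) = π * ν`, by which the Gamma integrals are rotated. -/
noncomputable def mainardiAngle (ν : ℝ) : ℝ := π * ν / (1 + ν)

theorem mainardiAngle_mul {ν : ℝ} (hν0 : 0 < ν) : mainardiAngle ν * (1 + ν) = π * ν := by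
  unfold mainardiAngle
  field_simp

theorem mainardiAngle_mem_Ioo {ν : ℝ} (hν0 : 0 < ν) (hν1 : ν < 1) :
    mainardiAngle ν ∈ Ioo (-(π / 2)) (π / 2) := by
  have hπ := pi_pos
  unfold mainardiAngle
  constructor
  · have : 0 < π * ν / (1 + ν) := by positivity
    linarith
  · rw [div_lt_iff₀ (by linarith)]
    nlinarith

theorem cos_mainardiAngle_pos {ν : ℝ} (hν0 : 0 < ν) (hν1 : ν < 1) : 0 < cos (mainardiAngle ν) :=
  cos_pos_of_mem_Ioo (mainardiAngle_mem_Ioo hν0 hν1)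

/-- The point `exp (I * φ)` of the unit circle, with `φ` the rotation angle. -/
noncomputable def mainardiDir (ν : ℝ) : ℂ := Complex.exp (mainardiAngle ν * Complex.I)

/-- The conjugate of the unit vector `mainardiDir ν`. -/
noncomputable def mainardiConj (ν : ℝ) : ℂ := Complex.exp ((-mainardiAngle ν : ℝ) * Complex.I)

theorem re_mainardiDir (ν : ℝ) : (mainardiDir ν).re = cos (mainardiAngle ν) :=
  Complex.exp_ofReal_mul_I_re _

theorem re_mainardiConj (ν : ℝ) : (mainardiConj ν).re = cos (mainardiAngle ν) :=
  (Complex.exp_ofReal_mul_I_re _).trans (cos_neg _)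

theorem norm_mainardiDir (ν : ℝ) : ‖mainardiDir ν‖ = 1 := Complex.norm_exp_ofReal_mul_I _

theorem norm_mainardiConj (ν : ℝ) : ‖mainardiConj ν‖ = 1 := Complex.norm_exp_ofReal_mul_I _

/-- The integrand in `t` whose integral over `(0, ∞)` has imaginary part `π * mainardi ν x`. -/
noncomputable def mainardiKernel (ν x t : ℝ) : ℂ :=
  ((t ^ (ν - 1) : ℝ) : ℂ) * mainardiDir ν *
    Complex.exp (-(mainardiDir ν * ((x * t ^ ν : ℝ) : ℂ))) * Complex.exp (-(mainardiConj ν * t))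

theorem measurable_mainardiKernel (ν : ℝ) :
    Measurable fun p : ℝ × ℝ => mainardiKernel ν p.1 p.2 := by
  unfold mainardiKernel
  fun_prop

theorem norm_mainardiKernel (ν x : ℝ) {t : ℝ} (ht : 0 < t) :
    ‖mainardiKernel ν x t‖ = t ^ (ν - 1) * exp (-(cos (mainardiAngle ν) * (x * t ^ ν))) *
      exp (-(cos (mainardiAngle ν) * t)) := by
  rw [mainardiKernel, norm_mul, norm_mul, norm_mul, norm_mainardiDir, Complex.norm_exp,
    Complex.norm_exp, Complex.norm_real, norm_of_nonneg (by positivity), Complex.neg_re,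
    Complex.re_mul_ofReal, Complex.neg_re, Complex.re_mul_ofReal, re_mainardiDir, re_mainardiConj,
    mul_one]

theorem integral_rpow_mul_cexp_neg_mainardiConj_mul {ν a : ℝ} (hν0 : 0 < ν) (hν1 : ν < 1)
    (ha : 0 < a) :
    ∫ t in Ioi (0 : ℝ), ((t ^ (a - 1) : ℝ) : ℂ) * Complex.exp (-(mainardiConj ν * t)) =
      (Gamma a : ℂ) * Complex.exp ((a * mainardiAngle ν : ℝ) * Complex.I) := by
  have hφ := mainardiAngle_mem_Ioo hν0 hν1
  have := integral_rpow_mul_cexp_neg_polar_mul (θ := -mainardiAngle ν) ha one_pos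
    ⟨by linarith [hφ.2], by linarith [hφ.1]⟩
  rw [one_rpow, one_mul, neg_mul_neg, Complex.ofReal_one] at this
  simpa only [one_mul] using! this

theorem Gamma_mul_sin_pi_mul {a : ℝ} (ha : 0 < a) :
    Gamma a * sin (π * a) = π / Gamma (1 - a) := by
  have hG := (Gamma_pos_of_pos ha).ne'
  have h := Real.Gamma_mul_Gamma_one_sub a
  rcases eq_or_ne (Gamma (1 - a)) 0 with h0 | h0
  · rw [h0, mul_zero, eq_comm, div_eq_zero_iff] at h
    rw [h0, h.resolve_left pi_ne_zero, div_zero, mul_zero]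
  · rw [eq_div_iff h0, mul_right_comm, h, div_mul_cancel₀]
    intro hs
    rw [hs, div_zero] at h
    exact mul_ne_zero hG h0 h

theorem hasSum_integral_mainardiKernel {ν : ℝ} (hν0 : 0 < ν) (hν1 : ν < 1) (x : ℝ) :
    HasSum (fun n : ℕ => ((π * ((-x) ^ n / (n.factorial * Gamma (1 - ν - ν * n)))) : ℝ))
      (∫ t in Ioi (0 : ℝ), mainardiKernel ν x t).im := by
  have hc := cos_mainardiAngle_pos hν0 hν1
  have hpow : ∀ t : ℝ, 0 < t → ∀ n : ℕ, t ^ (ν * (n + 1) - 1) = t ^ (ν - 1) * (t ^ ν) ^ n := by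
    intro t ht n
    rw [← rpow_natCast, ← rpow_mul ht.le, ← rpow_add ht]
    ring_nf
  have hexp : ∀ y : ℝ, HasSum (fun n : ℕ => y ^ n / n.factorial) (exp y) := fun y => by
    rw [Real.exp_eq_exp_ℝ]
    exact NormedSpace.expSeries_div_hasSum_exp y
  have hsum := hasSum_integral_of_dominated_convergence (μ := volume.restrict (Ioi (0 : ℝ)))
    (F := fun (n : ℕ) (t : ℝ) => ((-x) ^ n / n.factorial * mainardiDir ν ^ (n + 1) : ℂ) *
      (((t ^ (ν * (n + 1) - 1) : ℝ) : ℂ) * Complex.exp (-(mainardiConj ν * t))))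
    (f := mainardiKernel ν x)
    (fun (n : ℕ) (t : ℝ) => t ^ (ν - 1) * exp (-(cos (mainardiAngle ν) * t)) *
      ((|x| * t ^ ν) ^ n / n.factorial))
    (fun n => ((measurable_rpow_mul_cexp_neg_mul _ _).const_mul _).aestronglyMeasurable)
    ?_ ?_ ?_ ?_
  · have h := Complex.hasSum_im hsum
    refine h.congr_fun fun n => ?_
    have ha : 0 < ν * ((n : ℝ) + 1) := by positivity
    rw [integral_const_mul, integral_rpow_mul_cexp_neg_mainardiConj_mul hν0 hν1 ha, mainardiDir,
      ← Complex.exp_nat_mul]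
    have hangle : ((-x : ℂ) ^ n / n.factorial *
        Complex.exp (((n + 1 : ℕ) : ℂ) * (mainardiAngle ν * Complex.I))) *
        ((Gamma (ν * (n + 1)) : ℂ) *
          Complex.exp ((ν * (n + 1) * mainardiAngle ν : ℝ) * Complex.I)) =
        (((-x) ^ n / n.factorial * Gamma (ν * (n + 1)) : ℝ) : ℂ) *
          Complex.exp ((π * (ν * (n + 1)) : ℝ) * Complex.I) := by
      rw [show π * (ν * ((n : ℝ) + 1)) = (n + 1) * mainardiAngle ν +
        ν * (n + 1) * mainardiAngle ν by linear_combination -(n + 1 : ℝ) * mainardiAngle_mul hν0,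
        Complex.ofReal_add, add_mul, Complex.exp_add]
      push_cast
      ring_nf
    rw [hangle, Complex.im_ofReal_mul, Complex.exp_ofReal_mul_I_im, mul_assoc,
      Gamma_mul_sin_pi_mul ha, show 1 - ν * ((n : ℝ) + 1) = 1 - ν - ν * n by ring]
    ring
  · intro n
    filter_upwards [ae_restrict_mem measurableSet_Ioi] with t ht
    have ht : 0 < t := ht
    rw [norm_mul, norm_rpow_mul_cexp_neg_mul ht.le, re_mainardiConj, hpow t ht, norm_mul, norm_pow,
      norm_mainardiDir, norm_div, norm_pow, norm_neg, Complex.norm_real, Complex.norm_natCast,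
      norm_eq_abs]
    apply le_of_eq
    ring
  · filter_upwards with t
    exact ((hexp _).mul_left _).summable
  · simp_rw [fun t : ℝ => ((hexp (|x| * t ^ ν)).mul_left
      (t ^ (ν - 1) * exp (-(cos (mainardiAngle ν) * t)))).tsum_eq]
    exact integrableOn_rpow_mul_exp_neg_mul_mul_exp_mul_rpow (by linarith) hc hν0 hν1 _
  · filter_upwards [ae_restrict_mem measurableSet_Ioi] with t ht
    have ht : 0 < t := ht
    have h : HasSum (fun n : ℕ => (-(mainardiDir ν * ((x * t ^ ν : ℝ) : ℂ))) ^ n / n.factorial)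
        (Complex.exp (-(mainardiDir ν * ((x * t ^ ν : ℝ) : ℂ)))) := by
      rw [Complex.exp_eq_exp_ℂ]
      exact NormedSpace.expSeries_div_hasSum_exp _
    have h2 := (h.mul_left (((t ^ (ν - 1) : ℝ) : ℂ) * mainardiDir ν)).mul_right
      (Complex.exp (-(mainardiConj ν * t)))
    refine h2.congr_fun fun n => ?_
    rw [hpow t ht]
    push_cast
    rw [show -(mainardiDir ν * ((x : ℂ) * ((t ^ ν : ℝ) : ℂ))) =
      (-x : ℂ) * mainardiDir ν * ((t ^ ν : ℝ) : ℂ) by ring, mul_pow, mul_pow]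
    ring

theorem mainardi_eq_im_integral {ν : ℝ} (hν0 : 0 < ν) (hν1 : ν < 1) (x : ℝ) :
    mainardi ν x = (∫ t in Ioi (0 : ℝ), mainardiKernel ν x t).im / π := by
  rw [← (hasSum_integral_mainardiKernel hν0 hν1 x).tsum_eq, tsum_mul_left,
    mul_div_cancel_left₀ _ pi_ne_zero]
  rfl

theorem integrableOn_rpow_mul_mainardiDir_mul_cexp {ν x : ℝ} (hν0 : 0 < ν) (hν1 : ν < 1)
    (hx : 0 < x) :
    IntegrableOn (fun t : ℝ => ((t ^ (ν - 1) : ℝ) : ℂ) * mainardiDir ν *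
      Complex.exp (-(mainardiDir ν * ((x * t ^ ν : ℝ) : ℂ)))) (Ioi 0) := by
  have hc := cos_mainardiAngle_pos hν0 hν1
  refine (integrableOn_rpow_mul_exp_neg_mul_rpow (s := ν - 1) (by linarith) hν0
    (mul_pos hc hx)).mono' (Measurable.aestronglyMeasurable (by fun_prop)) ?_
  filter_upwards [ae_restrict_mem measurableSet_Ioi] with t ht
  have ht : 0 < t := ht
  rw [norm_mul, norm_mul, norm_mainardiDir, Complex.norm_exp, Complex.norm_real,
    norm_of_nonneg (by positivity), Complex.neg_re, Complex.re_mul_ofReal, re_mainardiDir, mul_one,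
    neg_mul, mul_assoc]

theorem integral_rpow_mul_mainardiDir_mul_cexp {ν x : ℝ} (hν0 : 0 < ν) (hν1 : ν < 1)
    (hx : 0 < x) :
    ∫ t in Ioi (0 : ℝ), ((t ^ (ν - 1) : ℝ) : ℂ) * mainardiDir ν *
      Complex.exp (-(mainardiDir ν * ((x * t ^ ν : ℝ) : ℂ))) = ((1 / (ν * x) : ℝ) : ℂ) := by
  have hc := cos_mainardiAngle_pos hν0 hν1
  have hν : (ν : ℂ) ≠ 0 := by exact_mod_cast hν0.ne'
  have hx' : (x : ℂ) ≠ 0 := by exact_mod_cast hx.ne'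
  have h := integral_Ioi_of_hasDerivAt_of_tendsto (a := 0) (m := 0)
    (f := fun t : ℝ => -((1 / (ν * x) : ℝ) : ℂ) *
      Complex.exp (-(mainardiDir ν * ((x * t ^ ν : ℝ) : ℂ)))) ?_ ?_
    (integrableOn_rpow_mul_mainardiDir_mul_cexp hν0 hν1 hx) ?_
  · rw [h]
    simp [zero_rpow hν0.ne']
  · have : Continuous fun t : ℝ => t ^ ν := continuous_id.rpow_const fun _ => Or.inr hν0.le
    exact Continuous.continuousWithinAt (by fun_prop)
  · intro t ht
    have ht : 0 < t := ht
    have h1 : HasDerivAt (fun t : ℝ => x * t ^ ν) (x * (ν * t ^ (ν - 1))) t :=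
      (Real.hasDerivAt_rpow_const (Or.inl ht.ne')).const_mul x
    convert! (((h1.ofReal_comp.const_mul (mainardiDir ν)).fun_neg).cexp).const_mul
      (-((1 / (ν * x) : ℝ) : ℂ)) using 1
    push_cast
    field_simp
  · refine squeeze_zero_norm (a := fun t : ℝ => 1 / (ν * x) *
      exp (-(cos (mainardiAngle ν) * (x * t ^ ν)))) (fun t => le_of_eq ?_) ?_
    · rw [norm_mul, norm_neg, Complex.norm_real, norm_of_nonneg (by positivity),
        Complex.norm_exp, Complex.neg_re, Complex.re_mul_ofReal, re_mainardiDir]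
    · have := (tendsto_exp_neg_atTop_nhds_zero.comp
        (((tendsto_rpow_atTop hν0).const_mul_atTop hx).const_mul_atTop hc)).const_mul (1 / (ν * x))
      simpa using! this

theorem integrableOn_mainardiKernel {ν x : ℝ} (hν0 : 0 < ν) (hν1 : ν < 1) (hx : 0 < x) :
    IntegrableOn (mainardiKernel ν x) (Ioi 0) := by
  have hc := cos_mainardiAngle_pos hν0 hν1
  refine Integrable.mono (integrableOn_rpow_mul_mainardiDir_mul_cexp hν0 hν1 hx)
    ((measurable_mainardiKernel ν).comp measurable_prodMk_left).aestronglyMeasurable ?_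
  filter_upwards [ae_restrict_mem measurableSet_Ioi] with t ht
  have ht : 0 < t := ht
  rw [mainardiKernel, norm_mul _ (Complex.exp (-(mainardiConj ν * t)))]
  refine mul_le_of_le_one_right (norm_nonneg _) ?_
  rw [Complex.norm_exp, Complex.neg_re, Complex.re_mul_ofReal, re_mainardiConj, exp_le_one_iff]
  have := mul_pos hc ht
  linarith

theorem exists_abs_mainardi_le {ν : ℝ} (hν0 : 0 < ν) (hν1 : ν < 1) :
    ∃ C : ℝ, ∀ x : ℝ, 0 < x → |mainardi ν x| ≤ C * x ^ (-(ν + 1) / ν) := by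
  have hc := cos_mainardiAngle_pos hν0 hν1
  have hπ := pi_pos
  refine ⟨2 * (cos (mainardiAngle ν) ^ (-(ν + 1) / ν) * (1 / ν) * Gamma ((ν + 1) / ν)) / π,
    fun x hx => ?_⟩
  have hK := integrableOn_mainardiKernel hν0 hν1 hx
  have hK0 := integrableOn_rpow_mul_mainardiDir_mul_cexp hν0 hν1 hx
  have him : (∫ t in Ioi (0 : ℝ), mainardiKernel ν x t).im =
      (∫ t in Ioi (0 : ℝ), (mainardiKernel ν x t - ((t ^ (ν - 1) : ℝ) : ℂ) * mainardiDir ν *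
        Complex.exp (-(mainardiDir ν * ((x * t ^ ν : ℝ) : ℂ))))).im := by
    rw [integral_sub hK hK0, integral_rpow_mul_mainardiDir_mul_cexp hν0 hν1 hx, Complex.sub_im,
      Complex.ofReal_im, sub_zero]
  have hbound : ‖∫ t in Ioi (0 : ℝ), (mainardiKernel ν x t - ((t ^ (ν - 1) : ℝ) : ℂ) *
        mainardiDir ν * Complex.exp (-(mainardiDir ν * ((x * t ^ ν : ℝ) : ℂ))))‖ ≤
      ∫ t in Ioi (0 : ℝ), 2 * (t ^ ν * exp (-(cos (mainardiAngle ν) * x) * t ^ ν)) := by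
    refine norm_integral_le_of_norm_le ((integrableOn_rpow_mul_exp_neg_mul_rpow (by linarith) hν0
      (mul_pos hc hx)).const_mul 2) ?_
    filter_upwards [ae_restrict_mem measurableSet_Ioi] with t ht
    have ht : 0 < t := ht
    rw [mainardiKernel, ← mul_sub_one, norm_mul, norm_mul, norm_mul, norm_mainardiDir,
      Complex.norm_exp, Complex.norm_real, norm_of_nonneg (by positivity), Complex.neg_re,
      Complex.re_mul_ofReal, re_mainardiDir]
    have h1 : ‖Complex.exp (-(mainardiConj ν * t)) - 1‖ ≤ 2 * t := by
      refine (norm_cexp_sub_one_le_of_re_nonpos ?_).trans_eq ?_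
      · rw [Complex.neg_re, Complex.re_mul_ofReal, re_mainardiConj]
        have := mul_pos hc ht
        linarith
      · rw [norm_neg, norm_mul, norm_mainardiConj, Complex.norm_real, norm_of_nonneg ht.le, one_mul]
    refine (mul_le_mul_of_nonneg_left h1 (by positivity)).trans_eq ?_
    have h2 : t ^ ν = t ^ (ν - 1) * t := by rw [← rpow_add_one ht.ne', sub_add_cancel]
    rw [neg_mul, mul_assoc (cos _), h2]
    ring
  rw [integral_const_mul, integral_rpow_mul_exp_neg_mul_rpow hν0 (by linarith) (mul_pos hc hx),
    mul_rpow hc.le hx.le] at hbound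
  rw [mainardi_eq_im_integral hν0 hν1, him, abs_div, abs_of_pos hπ, div_mul_eq_mul_div]
  gcongr
  refine (Complex.abs_im_le_norm _).trans (hbound.trans_eq ?_)
  ring

theorem integrable_rpow_mul_mainardiKernel {ν d : ℝ} (hν0 : 0 < ν) (hν1 : ν < 1) (hd0 : 0 < d)
    (hd1 : d < 1) :
    Integrable (Function.uncurry fun x t : ℝ => ((x ^ (-d) : ℝ) : ℂ) * mainardiKernel ν x t)
      ((volume.restrict (Ioi (0 : ℝ))).prod (volume.restrict (Ioi (0 : ℝ)))) := by
  have hc := cos_mainardiAngle_pos hν0 hν1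
  have hmeas : Measurable (Function.uncurry fun x t : ℝ =>
      ((x ^ (-d) : ℝ) : ℂ) * mainardiKernel ν x t) := by
    have := measurable_mainardiKernel ν
    unfold Function.uncurry
    fun_prop
  have hnorm : ∀ t : ℝ, 0 < t → ∀ x ∈ Ioi (0 : ℝ), ‖((x ^ (-d) : ℝ) : ℂ) * mainardiKernel ν x t‖ =
      t ^ (ν - 1) * exp (-(cos (mainardiAngle ν) * t)) *
        (x ^ (1 - d - 1) * exp (-(cos (mainardiAngle ν) * t ^ ν * x))) := by
    intro t ht x hx
    have hx : 0 < x := hx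
    rw [norm_mul, norm_mainardiKernel ν x ht, Complex.norm_real, norm_of_nonneg (by positivity)]
    ring_nf
  refine (integrable_prod_iff' hmeas.aestronglyMeasurable).2 ⟨?_, ?_⟩
  · filter_upwards [ae_restrict_mem measurableSet_Ioi] with t ht
    have ht : 0 < t := ht
    refine ((integrableOn_rpow_mul_exp_neg_mul (s := 1 - d - 1) (by linarith)
      (mul_pos hc (rpow_pos_of_pos ht ν))).const_mul
        (t ^ (ν - 1) * exp (-(cos (mainardiAngle ν) * t)))).mono'
      (hmeas.comp measurable_prodMk_right).aestronglyMeasurable ?_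
    filter_upwards [ae_restrict_mem measurableSet_Ioi] with x hx
    exact (hnorm t ht x hx).le
  · refine ((integrableOn_rpow_mul_exp_neg_mul (s := ν * d - 1) (b := cos (mainardiAngle ν))
      (by linarith [mul_pos hν0 hd0]) hc).const_mul
        (cos (mainardiAngle ν) ^ (-(1 - d)) * Gamma (1 - d))).congr ?_
    filter_upwards [ae_restrict_mem measurableSet_Ioi] with t ht
    have ht : 0 < t := ht
    simp only [Function.uncurry]
    rw [setIntegral_congr_fun measurableSet_Ioi (hnorm t ht), integral_const_mul,
      Real.integral_rpow_mul_exp_neg_mul_Ioi (sub_pos.2 hd1) (mul_pos hc (rpow_pos_of_pos ht ν)),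
      one_div, inv_rpow (by positivity), ← rpow_neg (by positivity), mul_rpow hc.le (by positivity),
      ← rpow_mul ht.le, show ν * d - 1 = (ν - 1) + ν * (-(1 - d)) by ring, rpow_add ht]
    ring

theorem integral_rpow_mul_integral_mainardiKernel {ν d : ℝ} (hν0 : 0 < ν) (hν1 : ν < 1)
    (hd0 : 0 < d) (hd1 : d < 1) :
    ∫ x in Ioi (0 : ℝ), ∫ t in Ioi (0 : ℝ), ((x ^ (-d) : ℝ) : ℂ) * mainardiKernel ν x t =
      ((Gamma (1 - d) * Gamma (ν * d) : ℝ) : ℂ) * Complex.exp ((π * (ν * d) : ℝ) * Complex.I) := by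
  rw [integral_integral_swap (integrable_rpow_mul_mainardiKernel hν0 hν1 hd0 hd1)]
  have hinner : ∀ t ∈ Ioi (0 : ℝ),
      ∫ x in Ioi (0 : ℝ), ((x ^ (-d) : ℝ) : ℂ) * mainardiKernel ν x t =
        (Gamma (1 - d) : ℂ) * Complex.exp ((d * mainardiAngle ν : ℝ) * Complex.I) *
          (((t ^ (ν * d - 1) : ℝ) : ℂ) * Complex.exp (-(mainardiConj ν * t))) := by
    intro t ht
    have ht : 0 < t := ht
    have hcongr : ∀ x ∈ Ioi (0 : ℝ), ((x ^ (-d) : ℝ) : ℂ) * mainardiKernel ν x t =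
        ((t ^ (ν - 1) : ℝ) : ℂ) * mainardiDir ν * Complex.exp (-(mainardiConj ν * t)) *
          (((x ^ (1 - d - 1) : ℝ) : ℂ) * Complex.exp (-(((t ^ ν : ℝ) : ℂ) *
            Complex.exp (mainardiAngle ν * Complex.I) * x))) := by
      intro x _
      rw [mainardiKernel, show 1 - d - 1 = -d by ring,
        show -(((t ^ ν : ℝ) : ℂ) * Complex.exp (mainardiAngle ν * Complex.I) * x) =
          -(mainardiDir ν * ((x * t ^ ν : ℝ) : ℂ)) by rw [mainardiDir]; push_cast; ring]
      ring
    rw [setIntegral_congr_fun measurableSet_Ioi hcongr, integral_const_mul,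
      integral_rpow_mul_cexp_neg_polar_mul (sub_pos.2 hd1) (rpow_pos_of_pos ht ν)
        (mainardiAngle_mem_Ioo hν0 hν1), ← rpow_mul ht.le,
      show ν * d - 1 = (ν - 1) + ν * (-(1 - d)) by ring, rpow_add ht,
      show d * mainardiAngle ν = mainardiAngle ν + -(1 - d) * mainardiAngle ν by ring,
      Complex.ofReal_add (mainardiAngle ν), add_mul, Complex.exp_add, mainardiDir]
    push_cast
    ring
  rw [setIntegral_congr_fun measurableSet_Ioi hinner, integral_const_mul,
    integral_rpow_mul_cexp_neg_mainardiConj_mul hν0 hν1 (mul_pos hν0 hd0),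
    show π * (ν * d) = d * mainardiAngle ν + ν * d * mainardiAngle ν by
      linear_combination -d * mainardiAngle_mul hν0,
    Complex.ofReal_add, add_mul, Complex.exp_add]
  push_cast
  ring

theorem integrableOn_rpow_mul_mainardi {ν d : ℝ} (hν0 : 0 < ν) (hν1 : ν < 1) (hd0 : 0 < d)
    (hd1 : d < 1) :
    IntegrableOn (fun x : ℝ => x ^ (-d) * mainardi ν x) (Ioi 0) := by
  have h := ((integrable_rpow_mul_mainardiKernel hν0 hν1 hd0 hd1).integral_prod_left.im).div_const π
  refine h.congr (.of_forall fun x => ?_)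
  simp only [Function.uncurry, integral_const_mul, RCLike.im_to_complex, Complex.im_ofReal_mul,
    mainardi_eq_im_integral hν0 hν1 x, mul_div_assoc]

theorem integral_rpow_mul_mainardi {ν d : ℝ} (hν0 : 0 < ν) (hν1 : ν < 1) (hd0 : 0 < d)
    (hd1 : d < 1) :
    ∫ x in Ioi (0 : ℝ), x ^ (-d) * mainardi ν x = Gamma (1 - d) / Gamma (1 - ν * d) := by
  have h := integral_im (integrable_rpow_mul_mainardiKernel hν0 hν1 hd0 hd1).integral_prod_left
  simp only [Function.uncurry, integral_rpow_mul_integral_mainardiKernel hν0 hν1 hd0 hd1] at h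
  simp only [integral_const_mul, RCLike.im_to_complex, Complex.im_ofReal_mul,
    Complex.exp_ofReal_mul_I_im] at h
  simp only [mainardi_eq_im_integral hν0 hν1, ← mul_div_assoc]
  rw [integral_div, h, mul_assoc, Gamma_mul_sin_pi_mul (mul_pos hν0 hd0)]
  have := pi_ne_zero
  field_simp

theorem integrableOn_mainardi {ν : ℝ} (hν0 : 0 < ν) (hν1 : ν < 1) :
    IntegrableOn (mainardi ν) (Ioi 0) := by
  have hd := integrableOn_rpow_mul_mainardi hν0 hν1 one_half_pos one_half_lt_one
  have hmeas : AEStronglyMeasurable (mainardi ν) (volume.restrict (Ioi (0 : ℝ))) := by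
    have hr : Measurable fun x : ℝ => x ^ (1 / 2 : ℝ) := by fun_prop
    refine (hr.aestronglyMeasurable.mul hd.aestronglyMeasurable).congr ?_
    filter_upwards [ae_restrict_mem measurableSet_Ioi] with x hx
    have hx : 0 < x := hx
    simp only [Pi.mul_apply]
    rw [← mul_assoc, ← rpow_add hx, add_neg_cancel, rpow_zero, one_mul]
  obtain ⟨C, hC⟩ := exists_abs_mainardi_le hν0 hν1
  rw [← Ioc_union_Ioi_eq_Ioi zero_le_one, integrableOn_union]
  constructor
  · refine Integrable.mono (hd.mono_set Ioc_subset_Ioi_self)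
      (hmeas.mono_measure (Measure.restrict_mono Ioc_subset_Ioi_self le_rfl)) ?_
    filter_upwards [ae_restrict_mem measurableSet_Ioc] with x hx
    rw [norm_mul, norm_of_nonneg (rpow_nonneg hx.1.le _)]
    exact le_mul_of_one_le_left (norm_nonneg _)
      (one_le_rpow_of_pos_of_le_one_of_nonpos hx.1 hx.2 (by norm_num))
  · have hs : -(ν + 1) / ν < -1 := by
      rw [div_lt_iff₀ hν0]
      linarith
    refine ((integrableOn_Ioi_rpow_of_lt hs one_pos).const_mul C).mono'
      (hmeas.mono_measure (Measure.restrict_mono (Ioi_subset_Ioi zero_le_one) le_rfl)) ?_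
    filter_upwards [ae_restrict_mem measurableSet_Ioi] with x hx
    exact hC x (one_pos.trans hx)

theorem mainardi_integral_eq_one (ν : ℝ) (hν0 : 0 < ν) (hν1 : ν < 1) :
    IntegrableOn (fun u : ℝ => mainardi ν u) (Ioi 0) ∧
    ∫ u in Ioi (0 : ℝ), mainardi ν u = 1 := by
  have hM := integrableOn_mainardi hν0 hν1
  have hd := integrableOn_rpow_mul_mainardi hν0 hν1 one_half_pos one_half_lt_one
  refine ⟨hM, ?_⟩
  have hsmall : ∀ᶠ d : ℝ in nhdsWithin 0 (Ioi 0), d ∈ Ioo (0 : ℝ) (1 / 2) :=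
    Ioo_mem_nhdsGT one_half_pos
  have hlim : Filter.Tendsto (fun d : ℝ => ∫ x in Ioi (0 : ℝ), x ^ (-d) * mainardi ν x)
      (nhdsWithin 0 (Ioi 0)) (nhds (∫ x in Ioi (0 : ℝ), mainardi ν x)) := by
    refine tendsto_integral_filter_of_dominated_convergence
      (fun x => ‖mainardi ν x‖ + ‖x ^ (-(1 / 2) : ℝ) * mainardi ν x‖) ?_ ?_
      (hM.norm.add hd.norm) ?_
    · filter_upwards [hsmall] with d hd
      exact (integrableOn_rpow_mul_mainardi hν0 hν1 hd.1 (by linarith [hd.2])).aestronglyMeasurable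
    · filter_upwards [hsmall] with d hd
      filter_upwards [ae_restrict_mem measurableSet_Ioi] with x hx
      have hx : 0 < x := hx
      rw [norm_mul, norm_mul, norm_of_nonneg (rpow_nonneg hx.le _),
        norm_of_nonneg (rpow_nonneg hx.le _), ← one_add_mul]
      gcongr
      rcases le_total x 1 with h | h
      · have := rpow_le_rpow_of_exponent_ge hx h (neg_le_neg hd.2.le)
        linarith
      · have h1 := rpow_le_one_of_one_le_of_nonpos h (neg_nonpos.2 hd.1.le)
        have h2 := rpow_nonneg hx.le (-(1 / 2))
        linarith
    · filter_upwards [ae_restrict_mem measurableSet_Ioi] with x hx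
      have hx : 0 < x := hx
      have hcont : Continuous fun d : ℝ => x ^ (-d) * mainardi ν x :=
        (continuous_const.rpow continuous_neg fun _ => Or.inl hx.ne').mul continuous_const
      exact (hcont.tendsto' 0 _ (by simp)).mono_left nhdsWithin_le_nhds
  have hGamma : ContinuousAt Gamma 1 :=
    (differentiableAt_Gamma fun m => by linarith [(m.cast_nonneg : (0 : ℝ) ≤ m)]).continuousAt
  have hlim2 : Filter.Tendsto (fun d : ℝ => Gamma (1 - d) / Gamma (1 - ν * d))
      (nhdsWithin 0 (Ioi 0)) (nhds 1) := by
    have h1 : Filter.Tendsto (fun d : ℝ => Gamma (1 - d)) (nhds 0) (nhds (Gamma 1)) :=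
      hGamma.tendsto.comp ((by fun_prop : Continuous fun d : ℝ => 1 - d).tendsto' 0 1 (by simp))
    have h2 : Filter.Tendsto (fun d : ℝ => Gamma (1 - ν * d)) (nhds 0) (nhds (Gamma 1)) :=
      hGamma.tendsto.comp ((by fun_prop : Continuous fun d : ℝ => 1 - ν * d).tendsto' 0 1 (by simp))
    have h := h1.div h2 (by simp)
    rw [Gamma_one, div_one] at h
    exact h.mono_left nhdsWithin_le_nhds
  refine tendsto_nhds_unique hlim (hlim2.congr' ?_)
  filter_upwards [hsmall] with d hd
  exact (integral_rpow_mul_mainardi hν0 hν1 hd.1 (by linarith [hd.2])).symm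
end

section
/- For every 0 < ν < 1, the first moment of the Mainardi function satisfies ∫₀^∞ u · M_ν(u) du = 1/Γ(1 + ν), the integral being convergent. -/
open Real MeasureTheory Set

theorem integrableOn_rpow_mul_cexp {s : ℝ} {z : ℂ} (hs : -1 < s) (hz : z.re < 0) :
    IntegrableOn (fun t : ℝ => ((t ^ s : ℝ) : ℂ) * Complex.exp (z * t)) (Ioi 0) := by
  have h := integrableOn_rpow_mul_exp_neg_mul_rpow hs one_pos (neg_pos.2 hz)
  simp only [neg_neg, Real.rpow_one] at h
  refine Integrable.mono' h (by fun_prop) ?_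
  refine (ae_restrict_mem measurableSet_Ioi).mono fun t ht => ?_
  rw [norm_mul, Complex.norm_exp, Complex.norm_of_nonneg (Real.rpow_nonneg (mem_Ioi.1 ht).le _)]
  simp

/-- The Mellin transform of `t ↦ exp (z * t)` for complex `z` in the left half-plane. -/
theorem integral_rpow_mul_cexp {a : ℝ} {z : ℂ} (ha : 0 < a) (hz : z.re < 0) :
    ∫ t : ℝ in Ioi 0, ((t ^ (a - 1) : ℝ) : ℂ) * Complex.exp (z * t) =
      (-z) ^ (-a : ℂ) * (Real.Gamma a : ℂ) := by
  set U : Set ℂ := {z | z.re < 0} with hU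
  have hUo : IsOpen U := isOpen_lt Complex.continuous_re continuous_const
  have hUc : IsPreconnected U := (convex_halfSpace_re_lt 0).isPreconnected
  have hf : DifferentiableOn ℂ
      (fun z : ℂ => ∫ t : ℝ in Ioi 0, ((t ^ (a - 1) : ℝ) : ℂ) * Complex.exp (z * t)) U := by
    intro z₀ hz₀
    have hz₀' : z₀.re < 0 := hz₀
    have hV : {z : ℂ | z.re < z₀.re / 2} ∈ nhds z₀ :=
      (isOpen_lt Complex.continuous_re continuous_const).mem_nhds
        (show z₀.re < z₀.re / 2 by linarith)
    have hb := integrableOn_rpow_mul_exp_neg_mul_rpow (show -1 < a by linarith) one_pos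
      (show 0 < -(z₀.re / 2) by linarith)
    simp only [neg_neg, Real.rpow_one] at hb
    refine (hasDerivAt_integral_of_dominated_loc_of_deriv_le
      (F := fun (z : ℂ) (t : ℝ) => ((t ^ (a - 1) : ℝ) : ℂ) * Complex.exp (z * t))
      (F' := fun (z : ℂ) (t : ℝ) => ((t ^ (a - 1) : ℝ) : ℂ) * (Complex.exp (z * t) * t)) hV
      (Filter.Eventually.of_forall fun z => by fun_prop)
      (integrableOn_rpow_mul_cexp (by linarith) hz₀') (by fun_prop) ?_ hb ?_).2
      |>.differentiableAt.differentiableWithinAt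
    · refine (ae_restrict_mem measurableSet_Ioi).mono fun t ht z hzV => ?_
      have ht : 0 < t := ht
      rw [norm_mul, norm_mul, Complex.norm_exp, Complex.norm_of_nonneg (Real.rpow_nonneg ht.le _),
        Complex.norm_of_nonneg ht.le, Real.rpow_sub_one ht.ne',
        show t ^ a / t * (rexp (z * t).re * t) = t ^ a * rexp (z * t).re by field_simp]
      gcongr
      simpa using mul_le_mul_of_nonneg_right (le_of_lt hzV) ht.le
    · refine Filter.Eventually.of_forall fun t z _ => ?_
      exact (((hasDerivAt_id z).mul_const (t : ℂ)).cexp.const_mul _).congr_deriv (by simp)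
  have hg : DifferentiableOn ℂ (fun z : ℂ => (-z) ^ (-a : ℂ) * (Real.Gamma a : ℂ)) U := by
    intro z hz
    refine DifferentiableAt.differentiableWithinAt ?_
    refine (differentiableAt_id.neg.cpow_const (Or.inl ?_)).mul_const _
    have hz : z.re < 0 := hz
    simpa using hz
  refine (hf.analyticOnNhd hUo).eqOn_of_preconnected_of_frequently_eq (hg.analyticOnNhd hUo) hUc
    (z₀ := (-1 : ℂ)) (by simp [hU]) ?_ hz
  have ht : Filter.Tendsto (fun t : ℝ => (t : ℂ)) (nhdsWithin (-1) (Iio (-1)))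
      (nhdsWithin (-1) {(-1 : ℂ)}ᶜ) := by
    refine tendsto_nhdsWithin_iff.2 ⟨?_, ?_⟩
    · exact ((Complex.continuous_ofReal.tendsto' (-1) (-1) (by simp))).mono_left nhdsWithin_le_nhds
    · filter_upwards [self_mem_nhdsWithin] with t ht
      have : t ≠ -1 := ne_of_lt ht
      simpa using fun h => this (by exact_mod_cast h)
  refine ht.frequently (Filter.Eventually.frequently ?_)
  filter_upwards [self_mem_nhdsWithin] with t ht
  have ht : 0 < -t := by have : t < -1 := ht; linarith
  have h := Real.integral_rpow_mul_exp_neg_mul_Ioi ha ht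
  rw [one_div, ← Real.rpow_neg_one, ← Real.rpow_mul ht.le] at h
  rw [← Complex.ofReal_neg, ← Complex.ofReal_neg, ← Complex.ofReal_cpow ht.le,
    ← Complex.ofReal_mul, show -a = -1 * a by ring, ← h, ← integral_complex_ofReal]
  refine integral_congr_ae (Filter.Eventually.of_forall fun u => ?_)
  simp

/-- A sublinear power in the exponent is absorbed by an exponentially decaying factor. -/
theorem integrableOn_rpow_mul_exp_mul_exp_rpow {ν s k y : ℝ} (hν0 : 0 < ν) (hν1 : ν < 1)
    (hs : -1 < s) (hk : k < 0) (hy : 0 ≤ y) :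
    IntegrableOn (fun t : ℝ => t ^ s * rexp (k * t) * rexp (y * t ^ ν)) (Ioi 0) := by
  set ε : ℝ := -k / 2 with hε
  have hε0 : 0 < ε := by linarith
  set B : ℝ := (y / ε ^ ν) ^ (1 - ν)⁻¹ with hB
  have hB0 : 0 ≤ B := by positivity
  have hyoung : ∀ t : ℝ, 0 ≤ t → y * t ^ ν ≤ ε * t + B := by
    intro t ht
    have h := Real.geom_mean_le_arith_mean2_weighted hν0.le (sub_pos.2 hν1).le
      (mul_nonneg hε0.le ht) hB0 (by ring)
    rw [hB, Real.rpow_inv_rpow (by positivity) (sub_pos.2 hν1).ne', ← hB,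
      Real.mul_rpow hε0.le ht] at h
    have hεν : ε ^ ν ≠ 0 := (Real.rpow_pos_of_pos hε0 ν).ne'
    have h' : ε ^ ν * t ^ ν * (y / ε ^ ν) = y * t ^ ν := by field_simp
    rw [h'] at h
    nlinarith [mul_nonneg hε0.le ht]
  have hb := (integrableOn_rpow_mul_exp_neg_mul_rpow hs one_pos hε0).mul_const (rexp B)
  simp only [Real.rpow_one] at hb
  refine Integrable.mono' hb (by fun_prop) ?_
  refine (ae_restrict_mem measurableSet_Ioi).mono fun t ht => ?_
  have ht : 0 < t := ht
  rw [Real.norm_of_nonneg (by positivity), mul_assoc, mul_assoc, ← Real.exp_add, ← Real.exp_add]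
  refine mul_le_mul_of_nonneg_left (Real.exp_le_exp.2 ?_) (by positivity)
  linarith [hyoung t ht.le, show k * t = -2 * (ε * t) by rw [hε]; ring]

theorem inv_Gamma_one_sub {a : ℝ} (ha : 0 < a) :
    (Real.Gamma (1 - a))⁻¹ = Real.Gamma a * Real.sin (π * a) / π := by
  have h := congrArg (·⁻¹) (Real.Gamma_mul_Gamma_one_sub a)
  simp only [mul_inv, inv_div] at h
  rw [mul_div_assoc, ← h, mul_inv_cancel_left₀ (Real.Gamma_pos_of_pos ha).ne']

theorem neg_exp_mul_I_cpow {θ : ℝ} (h0 : 0 < θ) (h1 : θ < π) (a : ℂ) :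
    (-Complex.exp (θ * Complex.I)) ^ a = Complex.exp (a * ((θ - π) * Complex.I)) := by
  have : -Complex.exp (θ * Complex.I) = Complex.exp ((θ - π) * Complex.I) := by
    rw [sub_mul, Complex.exp_sub, Complex.exp_pi_mul_I, div_neg, div_one]
  rw [this, Complex.cpow_def_of_ne_zero (Complex.exp_ne_zero _), Complex.log_exp, mul_comm]
  · simp; linarith
  · simp; linarith [Real.pi_pos]

theorem hasSum_pow_div_factorial_exp (y : ℝ) :
    HasSum (fun n : ℕ => y ^ n / n.factorial) (rexp y) := by
  rw [Real.exp_eq_exp_ℝ]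
  exact NormedSpace.expSeries_div_hasSum_exp y

theorem hasSum_pow_div_factorial_cexp (y : ℂ) :
    HasSum (fun n : ℕ => y ^ n / n.factorial) (Complex.exp y) := by
  rw [Complex.exp_eq_exp_ℂ]
  exact NormedSpace.expSeries_div_hasSum_exp y

/-- The Hankel representation of the Mainardi function along the rays of argument `±θ`,
with the two rays combined into an imaginary part. -/
theorem mainardi_eq_integral {ν θ : ℝ} (hν0 : 0 < ν) (hν1 : ν < 1) (hθ0 : π / 2 < θ) (hθ1 : θ < π)
    (x : ℝ) :
    mainardi ν x = (∫ t : ℝ in Ioi 0, Complex.exp ((θ * ν : ℝ) * Complex.I) *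
      ((t ^ (ν - 1) : ℝ) : ℂ) * Complex.exp (Complex.exp (θ * Complex.I) * t) *
      Complex.exp (-(x * Complex.exp ((θ * ν : ℝ) * Complex.I) * (t ^ ν : ℝ)))).im / π := by
  set w : ℂ := Complex.exp ((θ * ν : ℝ) * Complex.I) with hw
  set z : ℂ := Complex.exp (θ * Complex.I) with hz
  have hw1 : ‖w‖ = 1 := Complex.norm_exp_ofReal_mul_I _
  have hzre : z.re < 0 := by
    rw [hz, Complex.exp_ofReal_mul_I_re]
    exact Real.cos_neg_of_pi_div_two_lt_of_lt hθ0 (by linarith)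
  have hsum : ∀ t : ℝ, HasSum (fun n : ℕ => t ^ (ν - 1) * rexp (z.re * t) *
      ((|x| * t ^ ν) ^ n / n.factorial)) (t ^ (ν - 1) * rexp (z.re * t) * rexp (|x| * t ^ ν)) := by
    exact fun t => (hasSum_pow_div_factorial_exp _).mul_left _
  have key := hasSum_integral_of_dominated_convergence (μ := volume.restrict (Ioi (0 : ℝ)))
    (F := fun (n : ℕ) (t : ℝ) => w * ((t ^ (ν - 1) : ℝ) : ℂ) * Complex.exp (z * t) *
      ((-(x * w * (t ^ ν : ℝ))) ^ n / n.factorial))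
    (f := fun t : ℝ => w * ((t ^ (ν - 1) : ℝ) : ℂ) * Complex.exp (z * t) *
      Complex.exp (-(x * w * (t ^ ν : ℝ))))
    (fun (n : ℕ) (t : ℝ) => t ^ (ν - 1) * rexp (z.re * t) * ((|x| * t ^ ν) ^ n / n.factorial))
    (fun n => by fun_prop) ?_ (Filter.Eventually.of_forall fun t => (hsum t).summable) ?_ ?_
  · have him := (Complex.hasSum_im key).div_const π
    rw [← him.tsum_eq, mainardi]
    refine tsum_congr fun n => ?_
    set a : ℝ := ν * (n + 1) with ha
    have ha0 : 0 < a := by positivity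
    have hint : ∫ t : ℝ in Ioi 0, w * ((t ^ (ν - 1) : ℝ) : ℂ) * Complex.exp (z * t) *
        ((-(x * w * (t ^ ν : ℝ))) ^ n / n.factorial) =
        (((-x) ^ n / n.factorial * Real.Gamma a : ℝ) : ℂ) *
          Complex.exp ((π * a : ℝ) * Complex.I) := by
      have hexp : Complex.exp ((π * a : ℝ) * Complex.I) = w ^ (n + 1) * (-z) ^ (-a : ℂ) := by
        rw [neg_exp_mul_I_cpow (by linarith [Real.pi_pos]) hθ1, hw, ← Complex.exp_nat_mul,
          ← Complex.exp_add, ha]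
        congr 1
        push_cast
        ring
      rw [hexp]
      calc _ = ∫ t : ℝ in Ioi 0, (((-x) ^ n / n.factorial : ℝ) : ℂ) * w ^ (n + 1) *
            (((t ^ (a - 1) : ℝ) : ℂ) * Complex.exp (z * t)) := by
            refine setIntegral_congr_fun measurableSet_Ioi fun t ht => ?_
            have ht : 0 < t := ht
            have hpow : t ^ (a - 1) = t ^ (ν - 1) * (t ^ ν) ^ n := by
              rw [← Real.rpow_natCast, ← Real.rpow_mul ht.le, ← Real.rpow_add ht, ha]
              ring_nf
            simp only [hpow]
            push_cast
            rw [show -((x : ℂ) * w * ((t ^ ν : ℝ) : ℂ)) = -x * w * ((t ^ ν : ℝ) : ℂ) by ring,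
              mul_pow, mul_pow]
            ring
        _ = _ := by
            rw [integral_const_mul, integral_rpow_mul_cexp ha0 hzre]
            push_cast
            ring
    rw [hint, Complex.im_ofReal_mul, Complex.exp_ofReal_mul_I_im,
      show 1 - ν - ν * n = 1 - a by rw [ha]; ring, ← div_div, div_eq_mul_inv _ (Real.Gamma _),
      inv_Gamma_one_sub ha0]
    ring
  · refine fun n => (ae_restrict_mem measurableSet_Ioi).mono fun t ht => ?_
    have ht : 0 < t := ht
    refine le_of_eq ?_
    simp only [norm_mul, norm_div, norm_pow, norm_neg, hw1, Complex.norm_exp, Complex.norm_real,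
      Real.norm_eq_abs, abs_of_nonneg (Real.rpow_nonneg ht.le _), Complex.norm_natCast]
    simp
  · simp only [fun t => (hsum t).tsum_eq]
    exact integrableOn_rpow_mul_exp_mul_exp_rpow hν0 hν1 (by linarith) hzre (abs_nonneg x)
  · exact Filter.Eventually.of_forall fun t => (hasSum_pow_div_factorial_cexp _).mul_left _

theorem integral_rpow_mul_cexp_rpow {ν : ℝ} {r : ℂ} (hν : 0 < ν) (hr : 0 < r.re) :
    IntegrableOn (fun t : ℝ => ((t ^ (ν - 1) : ℝ) : ℂ) * Complex.exp (-(r * (t ^ ν : ℝ)))) (Ioi 0) ∧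
    ∫ t : ℝ in Ioi 0, ((t ^ (ν - 1) : ℝ) : ℂ) * Complex.exp (-(r * (t ^ ν : ℝ))) = 1 / (ν * r) := by
  have hr' : (-r).re < 0 := by simpa using hr
  have hνc : (ν : ℂ) ≠ 0 := by exact_mod_cast hν.ne'
  have hfun : (fun t : ℝ => ((t ^ (ν - 1) : ℝ) : ℂ) * Complex.exp (-(r * (t ^ ν : ℝ)))) =
      fun t : ℝ => (ν : ℂ)⁻¹ *
        ((|ν| * t ^ (ν - 1)) • (fun y : ℝ => Complex.exp (-r * y)) (t ^ ν)) := by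
    ext t
    simp only [abs_of_pos hν, Complex.real_smul, Complex.ofReal_mul, neg_mul]
    field_simp
  rw [hfun]
  constructor
  · exact ((integrableOn_Ioi_comp_rpow_iff _ hν.ne').2
      (integrableOn_exp_mul_complex_Ioi hr' 0)).const_mul _
  · rw [integral_const_mul,
      integral_comp_rpow_Ioi (fun y : ℝ => Complex.exp (-r * y)) hν.ne', integral_exp_mul_complex_Ioi hr']
    simp [mul_comm]

theorem norm_cexp_sub_one_le {z : ℂ} {t : ℝ} (hz1 : ‖z‖ = 1) (hz : z.re < 0) (ht : 0 < t) :
    ‖Complex.exp (z * t) - 1‖ ≤ 2 ∧ (t ≤ 1 → ‖Complex.exp (z * t) - 1‖ ≤ 2 * t) := by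
  constructor
  · refine (norm_sub_le _ _).trans ?_
    have : Real.exp (z * t).re ≤ 1 := by
      rw [Real.exp_le_one_iff]
      simpa using mul_nonpos_of_nonpos_of_nonneg hz.le ht.le
    rw [Complex.norm_exp, norm_one]
    linarith
  · intro h1
    have hn : ‖z * t‖ = t := by rw [norm_mul, hz1, one_mul, Complex.norm_of_nonneg ht.le]
    exact (Complex.norm_exp_sub_one_le (hn.trans_le h1)).trans_eq (by rw [hn])

theorem integrableOn_rpow_mul_cexp_sub_one {ν : ℝ} {z : ℂ} (hν0 : 0 < ν) (hν1 : ν < 1)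
    (hz1 : ‖z‖ = 1) (hz : z.re < 0) :
    IntegrableOn (fun t : ℝ => ((t ^ (-ν - 1) : ℝ) : ℂ) * (Complex.exp (z * t) - 1)) (Ioi 0) := by
  rw [← Ioc_union_Ioi_eq_Ioi zero_le_one]
  refine IntegrableOn.union ?_ ?_
  · have h : IntegrableOn (fun t : ℝ => 2 * t ^ (-ν)) (Ioc 0 1) :=
      ((intervalIntegrable_iff_integrableOn_Ioc_of_le zero_le_one).1
        (intervalIntegral.intervalIntegrable_rpow' (by linarith))).const_mul 2
    refine Integrable.mono' h (by fun_prop) ?_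
    refine (ae_restrict_mem measurableSet_Ioc).mono fun t ht => ?_
    rw [norm_mul, Complex.norm_of_nonneg (Real.rpow_nonneg ht.1.le _), Real.rpow_sub_one ht.1.ne']
    calc t ^ (-ν) / t * ‖Complex.exp (z * t) - 1‖ ≤ t ^ (-ν) / t * (2 * t) := by
          have := Real.rpow_nonneg ht.1.le (-ν)
          have := ht.1
          gcongr
          exact (norm_cexp_sub_one_le hz1 hz ht.1).2 ht.2
      _ = 2 * t ^ (-ν) := by have := ht.1.ne'; field_simp
  · have h : IntegrableOn (fun t : ℝ => t ^ (-ν - 1) * 2) (Ioi 1) :=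
      (integrableOn_Ioi_rpow_of_lt (by linarith) one_pos).mul_const 2
    refine Integrable.mono' h (by fun_prop) ?_
    refine (ae_restrict_mem measurableSet_Ioi).mono fun t ht => ?_
    have ht : 0 < t := zero_lt_one.trans ht
    rw [norm_mul, Complex.norm_of_nonneg (Real.rpow_nonneg ht.le _)]
    gcongr
    exact (norm_cexp_sub_one_le hz1 hz ht).1

theorem integral_rpow_mul_cexp_sub_one {ν : ℝ} {z : ℂ} (hν0 : 0 < ν) (hν1 : ν < 1)
    (hz1 : ‖z‖ = 1) (hz : z.re < 0) :
    ∫ t : ℝ in Ioi 0, ((t ^ (-ν - 1) : ℝ) : ℂ) * (Complex.exp (z * t) - 1) =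
      -((-z) ^ (ν : ℂ) * Real.Gamma (1 - ν)) / ν := by
  have hνc : (ν : ℂ) ≠ 0 := by exact_mod_cast hν0.ne'
  have hz0 : -z ≠ 0 := by
    rw [neg_ne_zero, ← norm_ne_zero_iff, hz1]
    exact one_ne_zero
  have hnorm : ∀ t : ℝ, 0 < t → ‖(Complex.exp (z * t) - 1) * (-(ν : ℂ)⁻¹ * ((t ^ (-ν) : ℝ) : ℂ))‖ =
      ‖Complex.exp (z * t) - 1‖ * (ν⁻¹ * t ^ (-ν)) := by
    intro t ht
    rw [norm_mul, norm_mul, norm_neg, norm_inv, Complex.norm_of_nonneg hν0.le,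
      Complex.norm_of_nonneg (Real.rpow_nonneg ht.le _)]
  have hparts := integral_Ioi_mul_deriv_eq_deriv_mul (a := 0) (a' := (0 : ℂ)) (b' := 0)
    (u := fun t : ℝ => Complex.exp (z * t) - 1) (u' := fun t : ℝ => z * Complex.exp (z * t))
    (v := fun t : ℝ => -(ν : ℂ)⁻¹ * ((t ^ (-ν) : ℝ) : ℂ)) (v' := fun t : ℝ => ((t ^ (-ν - 1) : ℝ) : ℂ))
    ?_ ?_ ?_ ?_ ?_ ?_
  · have h := integral_rpow_mul_cexp (show 0 < 1 - ν by linarith) hz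
    rw [show 1 - ν - 1 = -ν by ring] at h
    have hL : ∫ t : ℝ in Ioi 0, ((t ^ (-ν - 1) : ℝ) : ℂ) * (Complex.exp (z * t) - 1) =
        ∫ t : ℝ in Ioi 0, (Complex.exp (z * t) - 1) * ((t ^ (-ν - 1) : ℝ) : ℂ) := by
      simp only [mul_comm]
    have hR : ∫ t : ℝ in Ioi 0, z * Complex.exp (z * t) * (-(ν : ℂ)⁻¹ * ((t ^ (-ν) : ℝ) : ℂ)) =
        -(ν : ℂ)⁻¹ * z * ∫ t : ℝ in Ioi 0, ((t ^ (-ν) : ℝ) : ℂ) * Complex.exp (z * t) := by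
      rw [← integral_const_mul]
      exact integral_congr_ae (Filter.Eventually.of_forall fun t => by ring)
    have hpow : (-z) ^ (ν : ℂ) = (-z) * (-z) ^ (-((1 - ν : ℝ) : ℂ)) := by
      nth_rewrite 2 [← Complex.cpow_one (-z)]
      rw [← Complex.cpow_add _ _ hz0]
      congr 1
      push_cast
      ring
    rw [hL, hparts, hR, h, hpow]
    field_simp
    ring
  · intro t _
    have h := (((hasDerivAt_id (t : ℂ)).const_mul z).cexp.comp_ofReal).sub_const 1
    exact h.congr_deriv (by simp [mul_comm])
  · intro t ht
    have h := ((Real.hasDerivAt_rpow_const (p := -ν) (Or.inl (ne_of_gt ht))).ofReal_comp).const_mul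
      (-(ν : ℂ)⁻¹)
    refine h.congr_deriv ?_
    push_cast
    field_simp
  · refine (integrableOn_rpow_mul_cexp_sub_one hν0 hν1 hz1 hz).congr ?_
    exact Filter.Eventually.of_forall fun t => mul_comm _ _
  · refine ((integrableOn_rpow_mul_cexp (show -1 < -ν by linarith) hz).const_mul
      (-(ν : ℂ)⁻¹ * z)).congr ?_
    exact Filter.Eventually.of_forall fun t => by simp only [Pi.mul_apply]; ring
  · have hlim : Filter.Tendsto (fun t : ℝ => 2 * ν⁻¹ * t ^ (1 - ν)) (nhdsWithin 0 (Ioi 0))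
        (nhds 0) := by
      have hc : Continuous fun t : ℝ => 2 * ν⁻¹ * t ^ (1 - ν) :=
        continuous_const.mul (Real.continuous_rpow_const (by linarith))
      exact (hc.tendsto' 0 0 (by
        rw [Real.zero_rpow (by linarith), mul_zero])).mono_left nhdsWithin_le_nhds
    refine squeeze_zero_norm' ?_ hlim
    filter_upwards [Ioc_mem_nhdsGT (zero_lt_one' ℝ)] with t ht
    rw [Pi.mul_apply, hnorm t ht.1, sub_eq_add_neg 1 ν, Real.rpow_add ht.1, Real.rpow_one]
    have := Real.rpow_nonneg ht.1.le (-ν)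
    calc _ ≤ 2 * t * (ν⁻¹ * t ^ (-ν)) := by
          gcongr
          exact (norm_cexp_sub_one_le hz1 hz ht.1).2 ht.2
      _ = _ := by ring
  · have hlim : Filter.Tendsto (fun t : ℝ => 2 * (ν⁻¹ * t ^ (-ν))) Filter.atTop (nhds 0) := by
      simpa using ((tendsto_rpow_neg_atTop hν0).const_mul ν⁻¹).const_mul 2
    refine squeeze_zero_norm' ?_ hlim
    filter_upwards [Filter.eventually_gt_atTop 0] with t ht
    rw [Pi.mul_apply, hnorm t ht]
    gcongr
    exact (norm_cexp_sub_one_le hz1 hz ht).1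

/-- The first moment of the kernel of the regularised Hankel representation. -/
theorem integral_mul_hankel_kernel {ν : ℝ} {z w : ℂ} (hν0 : 0 < ν) (hν1 : ν < 1)
    (hz1 : ‖z‖ = 1) (hz : z.re < 0) (hw : 0 < w.re) :
    Integrable (fun u : ℝ => ∫ t : ℝ in Ioi 0, (u : ℂ) * (w * ((t ^ (ν - 1) : ℝ) : ℂ) *
      (Complex.exp (z * t) - 1) * Complex.exp (-(u * w * (t ^ ν : ℝ)))))
      (volume.restrict (Ioi 0)) ∧
    ∫ u : ℝ in Ioi 0, ∫ t : ℝ in Ioi 0, (u : ℂ) * (w * ((t ^ (ν - 1) : ℝ) : ℂ) *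
      (Complex.exp (z * t) - 1) * Complex.exp (-(u * w * (t ^ ν : ℝ)))) =
      w⁻¹ * (-((-z) ^ (ν : ℂ) * Real.Gamma (1 - ν)) / ν) := by
  have hw0 : w ≠ 0 := by rintro rfl; simp at hw
  have hfun : ∀ t u : ℝ, (u : ℂ) * (w * ((t ^ (ν - 1) : ℝ) : ℂ) * (Complex.exp (z * t) - 1) *
      Complex.exp (-(u * w * (t ^ ν : ℝ)))) = w * ((t ^ (ν - 1) : ℝ) : ℂ) *
      (Complex.exp (z * t) - 1) *
        (((u ^ ((2 : ℝ) - 1) : ℝ) : ℂ) * Complex.exp (-(w * (t ^ ν : ℝ)) * u)) := by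
    intro t u
    rw [show (2 : ℝ) - 1 = 1 by norm_num, Real.rpow_one,
      show -((u : ℂ) * w * ((t ^ ν : ℝ) : ℂ)) = -(w * ((t ^ ν : ℝ) : ℂ)) * u by ring]
    ring
  have hre : ∀ t : ℝ, 0 < t → (-(w * ((t ^ ν : ℝ) : ℂ))).re < 0 := by
    intro t ht
    rw [Complex.neg_re, Complex.re_mul_ofReal, neg_lt_zero]
    positivity
  have hint : Integrable (Function.uncurry fun t u : ℝ => (u : ℂ) * (w * ((t ^ (ν - 1) : ℝ) : ℂ) *
      (Complex.exp (z * t) - 1) * Complex.exp (-(u * w * (t ^ ν : ℝ)))))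
      ((volume.restrict (Ioi 0)).prod (volume.restrict (Ioi 0))) := by
    refine (integrable_prod_iff (by unfold Function.uncurry; fun_prop)).2 ⟨?_, ?_⟩
    · refine (ae_restrict_mem measurableSet_Ioi).mono fun t ht => ?_
      simp only [Function.uncurry_apply_pair, hfun t]
      exact (integrableOn_rpow_mul_cexp (by norm_num) (hre t ht)).const_mul _
    · refine (((integrableOn_rpow_mul_cexp_sub_one hν0 hν1 hz1 hz).norm).const_mul
        (‖w‖ * (w.re ^ 2)⁻¹)).congr ?_
      refine (ae_restrict_mem measurableSet_Ioi).mono fun t ht => ?_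
      have ht : 0 < t := ht
      simp only [Function.uncurry_apply_pair, hfun t]
      have htν : 0 < t ^ ν := by positivity
      have hpos : 0 < w.re * t ^ ν := by positivity
      have hΓ := Real.integral_rpow_mul_exp_neg_mul_Ioi two_pos hpos
      have hinner : ∫ u : ℝ in Ioi 0, ‖((u ^ ((2 : ℝ) - 1) : ℝ) : ℂ) *
          Complex.exp (-(w * (t ^ ν : ℝ)) * u)‖ = ((w.re * t ^ ν) ^ 2)⁻¹ := by
        rw [Real.Gamma_two, mul_one, Real.rpow_two, one_div, inv_pow] at hΓ
        rw [← hΓ]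
        refine setIntegral_congr_fun measurableSet_Ioi fun u hu => ?_
        simp only [norm_mul, Complex.norm_exp,
          Complex.norm_of_nonneg (Real.rpow_nonneg (le_of_lt (mem_Ioi.1 hu)) _)]
        rw [Complex.re_mul_ofReal, Complex.neg_re, Complex.re_mul_ofReal, neg_mul]
      simp only [norm_mul _ (_ * _)]
      rw [integral_const_mul]
      simp only [norm_mul] at hinner ⊢
      rw [hinner, Complex.norm_of_nonneg (Real.rpow_nonneg ht.le _),
        Complex.norm_of_nonneg (Real.rpow_nonneg ht.le _), Real.rpow_sub_one ht.ne',
        Real.rpow_sub_one ht.ne', Real.rpow_neg ht.le]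
      field_simp
  refine ⟨hint.integral_prod_right, ?_⟩
  rw [← integral_integral_swap hint, ← integral_rpow_mul_cexp_sub_one hν0 hν1 hz1 hz,
    ← integral_const_mul]
  refine setIntegral_congr_fun measurableSet_Ioi fun t ht => ?_
  have ht : 0 < t := ht
  have htν : ((t ^ ν : ℝ) : ℂ) ≠ 0 := by
    exact_mod_cast (Real.rpow_pos_of_pos ht ν).ne'
  have htc : (t : ℂ) ≠ 0 := by exact_mod_cast ht.ne'
  simp only [hfun t]
  rw [integral_const_mul, integral_rpow_mul_cexp two_pos (hre t ht), neg_neg, Real.Gamma_two,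
    Complex.cpow_neg, Complex.ofReal_ofNat, Complex.cpow_ofNat, Real.rpow_sub_one ht.ne',
    Real.rpow_sub_one ht.ne', Real.rpow_neg ht.le]
  push_cast
  field_simp

theorem mainardi_first_moment (ν : ℝ) (hν0 : 0 < ν) (hν1 : ν < 1) :
    IntegrableOn (fun u : ℝ => u * mainardi ν u) (Ioi 0) ∧
    ∫ u in Ioi (0 : ℝ), u * mainardi ν u = 1 / Real.Gamma (1 + ν) := by
  have hπ := Real.pi_pos
  set θ : ℝ := π / (1 + ν) with hθ
  have hθ0 : π / 2 < θ := div_lt_div_of_pos_left hπ (by linarith) (by linarith)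
  have hθ1 : θ < π := div_lt_self hπ (by linarith)
  have hθν : θ * ν < π / 2 := by
    rw [hθ, div_mul_eq_mul_div, div_lt_div_iff₀ (by linarith) two_pos]
    nlinarith
  set w : ℂ := Complex.exp ((θ * ν : ℝ) * Complex.I) with hw
  set z : ℂ := Complex.exp (θ * Complex.I) with hz
  have hz1 : ‖z‖ = 1 := Complex.norm_exp_ofReal_mul_I _
  have hzre : z.re < 0 := by
    rw [hz, Complex.exp_ofReal_mul_I_re]
    exact Real.cos_neg_of_pi_div_two_lt_of_lt hθ0 (by linarith)
  have hwre : 0 < w.re := by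
    rw [hw, Complex.exp_ofReal_mul_I_re]
    exact Real.cos_pos_of_mem_Ioo ⟨by nlinarith, hθν⟩
  have hw0 : w ≠ 0 := Complex.exp_ne_zero _
  obtain ⟨hint, hval⟩ := integral_mul_hankel_kernel hν0 hν1 hz1 hzre hwre
  set K : ℝ → ℂ := fun u => ∫ t : ℝ in Ioi 0, (u : ℂ) * (w * ((t ^ (ν - 1) : ℝ) : ℂ) *
      (Complex.exp (z * t) - 1) * Complex.exp (-(u * w * (t ^ ν : ℝ)))) with hK
  have hrep : ∀ u ∈ Ioi (0 : ℝ), u * mainardi ν u = (K u).im / π := by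
    intro u hu
    have hu : 0 < u := hu
    have huc : (u : ℂ) ≠ 0 := by exact_mod_cast hu.ne'
    obtain ⟨hi, hv⟩ := integral_rpow_mul_cexp_rpow (r := u * w) hν0
      (by rw [Complex.re_ofReal_mul]; positivity)
    have hbig : IntegrableOn (fun t : ℝ => w * ((t ^ (ν - 1) : ℝ) : ℂ) * Complex.exp (z * t) *
        Complex.exp (-(u * w * (t ^ ν : ℝ)))) (Ioi 0) := by
      refine Integrable.mono' (hi.norm.const_mul ‖w‖) (by fun_prop) ?_
      refine (ae_restrict_mem measurableSet_Ioi).mono fun t ht => ?_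
      have ht : 0 < t := ht
      have : ‖Complex.exp (z * t)‖ ≤ 1 := by
        rw [Complex.norm_exp, Real.exp_le_one_iff, Complex.re_mul_ofReal]
        exact mul_nonpos_of_nonpos_of_nonneg hzre.le ht.le
      rw [mul_right_comm, mul_assoc w, norm_mul, norm_mul w]
      exact mul_le_of_le_one_right (by positivity) this
    have hsub : K u = u * ((∫ t : ℝ in Ioi 0, w * ((t ^ (ν - 1) : ℝ) : ℂ) *
        Complex.exp (z * t) * Complex.exp (-(u * w * (t ^ ν : ℝ)))) - w * (1 / (ν * (u * w)))) := by
      rw [← hv, ← integral_const_mul w, ← integral_sub hbig (hi.const_mul w), ← integral_const_mul]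
      exact integral_congr_ae (Filter.Eventually.of_forall fun t => by ring)
    have hreal : w * (1 / (ν * (u * w))) = ((1 / (ν * u) : ℝ) : ℂ) := by
      push_cast
      field_simp
    rw [hsub, hreal, Complex.im_ofReal_mul, Complex.sub_im, Complex.ofReal_im, sub_zero,
      mainardi_eq_integral hν0 hν1 hθ0 hθ1 u, mul_div_assoc]
  have hKim : Integrable (fun u => (K u).im / π) (volume.restrict (Ioi 0)) := hint.im.div_const π
  refine ⟨hKim.congr ((ae_restrict_mem measurableSet_Ioi).mono fun u hu => (hrep u hu).symm), ?_⟩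
  have hKint : ∫ u in Ioi (0 : ℝ), (K u).im = (∫ u in Ioi (0 : ℝ), K u).im := integral_im hint
  have hexp : w⁻¹ * (-((-z) ^ (ν : ℂ) * Real.Gamma (1 - ν)) / ν) =
      ((-(Real.Gamma (1 - ν) / ν) : ℝ) : ℂ) * Complex.exp ((-(π * ν) : ℝ) * Complex.I) := by
    have : Complex.exp ((-(π * ν) : ℝ) * Complex.I) = w⁻¹ * (-z) ^ (ν : ℂ) := by
      rw [neg_exp_mul_I_cpow (by linarith) hθ1, hw, ← Complex.exp_neg, ← Complex.exp_add]
      congr 1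
      push_cast
      ring
    rw [this]
    push_cast
    ring
  rw [setIntegral_congr_fun measurableSet_Ioi hrep, integral_div, hKint, hval, hexp,
    Complex.im_ofReal_mul, Complex.exp_ofReal_mul_I_im, Real.sin_neg, add_comm,
    Real.Gamma_add_one hν0.ne', one_div, mul_inv]
  have h1 := inv_Gamma_one_sub (a := 1 - ν) (by linarith)
  rw [sub_sub_cancel, mul_sub, mul_one, Real.sin_pi_sub] at h1
  rw [h1]
  field_simp
end

section
/- For every 1/2 ≤ ν < 1, the function x ↦ ∫₀^x M_ν(u) du is strictly increasing on [0,∞) and tends to 1 as x → ∞. -/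
open Real MeasureTheory Set Filter

/-- Reflection formula for the reciprocal Gamma function, valid also at the poles. -/
theorem Real.inv_Gamma_one_sub {s : ℝ} (hs : 0 < s) :
    (Gamma (1 - s))⁻¹ = Gamma s * sin (π * s) / π := by
  have h := Real.Gamma_mul_Gamma_one_sub s
  have hG := (Gamma_pos_of_pos hs).ne'
  have : Gamma (1 - s) = π / sin (π * s) / Gamma s := by
    rw [← h]; field_simp
  rw [this, inv_div, div_div_eq_mul_div]

theorem exists_mul_rpow_le_add_half {ν x : ℝ} (h0 : 0 < ν) (h1 : ν < 1) (hx : 0 ≤ x) :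
    ∃ C, ∀ t, 0 < t → x * t ^ ν ≤ C + t / 2 := by
  refine ⟨x * ((2 * x) ^ (1 / (1 - ν))) ^ ν, fun t ht => ?_⟩
  rcases le_total t ((2 * x) ^ (1 / (1 - ν))) with h | h
  · have : x * t ^ ν ≤ x * ((2 * x) ^ (1 / (1 - ν))) ^ ν := by gcongr
    linarith
  · have h2 : 2 * x ≤ t ^ (1 - ν) := by
      calc 2 * x = ((2 * x) ^ (1 / (1 - ν))) ^ (1 - ν) := by
            rw [← rpow_mul (by positivity), one_div_mul_cancel (by linarith), rpow_one]
        _ ≤ t ^ (1 - ν) := by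
            have : 0 ≤ 1 - ν := by linarith
            gcongr
    have h3 : t ^ (1 - ν) * t ^ ν = t := by
      rw [← rpow_add ht]; simp
    have h4 : 0 ≤ x * ((2 * x) ^ (1 / (1 - ν))) ^ ν := by positivity
    nlinarith [rpow_pos_of_pos ht ν]

theorem integrableOn_exp_neg_mul_rpow_mul_exp {ν x : ℝ} (h0 : 0 < ν) (h1 : ν < 1) (hx : 0 ≤ x) :
    IntegrableOn (fun t : ℝ => exp (-t) * t ^ (ν - 1) * exp (x * t ^ ν)) (Ioi 0) := by
  obtain ⟨C, hC⟩ := exists_mul_rpow_le_add_half h0 h1 hx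
  have hi : IntegrableOn (fun t : ℝ => exp C * (t ^ (ν - 1) * exp (-(1 / 2) * t ^ (1 : ℝ))))
      (Ioi 0) :=
    (integrableOn_rpow_mul_exp_neg_mul_rpow (by linarith) one_pos (by norm_num)).const_mul _
  refine hi.mono' (by fun_prop) ?_
  filter_upwards [ae_restrict_mem measurableSet_Ioi] with t (ht : 0 < t)
  rw [norm_of_nonneg (by positivity), rpow_one]
  calc exp (-t) * t ^ (ν - 1) * exp (x * t ^ ν)
      ≤ exp (-t) * t ^ (ν - 1) * exp (C + t / 2) := by gcongr; exact hC t ht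
    _ = t ^ (ν - 1) * (exp (-t) * exp (C + t / 2)) := by ring
    _ = t ^ (ν - 1) * (exp C * exp (-(1 / 2) * t)) := by
        rw [← exp_add, ← exp_add]; ring_nf
    _ = _ := by ring

theorem rpow_mul_natCast_add_one_sub_one {ν t : ℝ} (ht : 0 < t) (n : ℕ) :
    t ^ (ν * (n + 1) - 1) = t ^ (ν - 1) * (t ^ ν) ^ n := by
  rw [← rpow_natCast, ← rpow_mul ht.le, ← rpow_add ht]; ring_nf

theorem summable_pow_div_factorial_mul_Gamma {ν x : ℝ} (h0 : 0 < ν) (h1 : ν < 1) (hx : 0 ≤ x) :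
    Summable (fun n : ℕ => x ^ n / n.factorial * Gamma (ν * (n + 1))) := by
  have key := hasSum_integral_of_dominated_convergence (μ := volume.restrict (Ioi (0 : ℝ)))
    (F := fun (n : ℕ) (t : ℝ) => x ^ n / n.factorial * (exp (-t) * t ^ (ν * (n + 1) - 1)))
    (f := fun t => exp (-t) * t ^ (ν - 1) * exp (x * t ^ ν))
    (fun n t => exp (-t) * t ^ (ν - 1) * ((x * t ^ ν) ^ n / n.factorial)) (fun n => by fun_prop)
    (fun n => ?_) (Eventually.of_forall fun t => ?_) ?_ ?_
  · refine key.summable.congr fun n => ?_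
    rw [integral_const_mul, ← Gamma_eq_integral (by positivity)]
  · filter_upwards [ae_restrict_mem measurableSet_Ioi] with t (ht : 0 < t)
    rw [norm_of_nonneg (by positivity), rpow_mul_natCast_add_one_sub_one ht, mul_pow]
    apply le_of_eq; ring
  · exact (summable_pow_div_factorial _).mul_left _
  · refine (integrableOn_exp_neg_mul_rpow_mul_exp h0 h1 hx).congr (Eventually.of_forall fun t => ?_)
    simp only
    rw [tsum_mul_left, exp_eq_exp_ℝ, NormedSpace.exp_eq_tsum_div]
  · filter_upwards [ae_restrict_mem measurableSet_Ioi] with t (ht : 0 < t)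
    have := (NormedSpace.expSeries_div_hasSum_exp (x * t ^ ν)).mul_left (exp (-t) * t ^ (ν - 1))
    rw [← exp_eq_exp_ℝ] at this
    refine this.congr_fun fun n => ?_
    rw [rpow_mul_natCast_add_one_sub_one ht, mul_pow]
    ring

/-- The integrand obtained by collapsing the Hankel contour onto the negative real axis. -/
noncomputable def hankelIntegrand (ν x t : ℝ) : ℝ :=
  exp (-t) / t * (Complex.exp (-x * (t ^ ν : ℝ) * Complex.exp (π * ν * Complex.I))).im

theorem hasSum_hankelIntegrand {ν x t : ℝ} (ht : 0 < t) :
    HasSum (fun n : ℕ => (-x) ^ (n + 1) / (n + 1).factorial * sin (π * (ν * (n + 1))) *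
      (exp (-t) * t ^ (ν * (n + 1) - 1))) (hankelIntegrand ν x t) := by
  set z : ℂ := -x * (t ^ ν : ℝ) * Complex.exp (π * ν * Complex.I)
  have h := (hasSum_nat_add_iff' 1).2 (NormedSpace.expSeries_div_hasSum_exp z)
  rw [← Complex.exp_eq_exp_ℂ] at h
  have h2 := (Complex.imCLM.hasSum h).mul_left (exp (-t) / t)
  simp only [Complex.imCLM_apply, Finset.range_one, Finset.sum_singleton,
    pow_zero, Nat.factorial_zero, Nat.cast_one, div_one, Complex.sub_im, Complex.one_im,
    sub_zero] at h2
  refine h2.congr_fun fun n => ?_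
  have hz : z ^ (n + 1) / ((n + 1).factorial : ℂ) =
      (((-x) ^ (n + 1) * (t ^ ν) ^ (n + 1) / (n + 1).factorial : ℝ) : ℂ) *
        Complex.exp ((π * (ν * (n + 1)) : ℝ) * Complex.I) := by
    simp only [z]
    rw [mul_pow, mul_pow, ← Complex.exp_nat_mul]
    push_cast
    ring_nf
  rw [hz, Complex.im_ofReal_mul, Complex.exp_ofReal_mul_I_im, rpow_mul_natCast_add_one_sub_one ht,
    rpow_sub_one ht.ne']
  ring

theorem integrableOn_hankelIntegrand {ν x : ℝ} (h0 : 0 < ν) (h1 : ν < 1) (hx : 0 ≤ x) :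
    IntegrableOn (hankelIntegrand ν x) (Ioi 0) := by
  refine ((integrableOn_exp_neg_mul_rpow_mul_exp h0 h1 hx).const_mul x).mono'
    (by unfold hankelIntegrand; fun_prop) ?_
  filter_upwards [ae_restrict_mem measurableSet_Ioi] with t (ht : 0 < t)
  unfold hankelIntegrand
  set z : ℂ := -x * (t ^ ν : ℝ) * Complex.exp (π * ν * Complex.I) with hz
  have hzn : ‖z‖ = x * t ^ ν := by
    rw [hz, norm_mul, norm_mul, norm_neg, Complex.norm_real, Complex.norm_real,
      ← Complex.ofReal_mul, Complex.norm_exp_ofReal_mul_I, norm_of_nonneg hx,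
      norm_of_nonneg (by positivity), mul_one]
  have h := Complex.norm_exp_sub_sum_le_norm_mul_exp z 1
  have him : |(Complex.exp z).im| ≤ ‖z‖ * exp ‖z‖ := by
    refine le_trans ?_ (by simpa using h)
    simpa using Complex.abs_im_le_norm (Complex.exp z - 1)
  rw [norm_mul, norm_of_nonneg (by positivity : 0 ≤ exp (-t) / t), norm_eq_abs]
  rw [hzn] at him
  calc exp (-t) / t * |(Complex.exp z).im| ≤ exp (-t) / t * (x * t ^ ν * exp (x * t ^ ν)) := by
        gcongr
    _ = _ := by rw [rpow_sub_one ht.ne']; ring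

theorem hasSum_integral_hankelIntegrand {ν x : ℝ} (h0 : 0 < ν) (h1 : ν < 1) (hx : 0 ≤ x) :
    HasSum (fun n : ℕ => (-x) ^ (n + 1) / (n + 1).factorial * (Gamma (1 - ν * (n + 1)))⁻¹)
      ((∫ t in Ioi 0, hankelIntegrand ν x t) / π) := by
  have key := hasSum_integral_of_dominated_convergence (μ := volume.restrict (Ioi (0 : ℝ)))
    (F := fun (n : ℕ) (t : ℝ) => (-x) ^ (n + 1) / (n + 1).factorial * sin (π * (ν * (n + 1))) *
      (exp (-t) * t ^ (ν * (n + 1) - 1)))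
    (f := hankelIntegrand ν x)
    (fun n t => x * (exp (-t) * t ^ (ν - 1)) * ((x * t ^ ν) ^ n / n.factorial))
    (fun n => by fun_prop) (fun n => ?_) (Eventually.of_forall fun t => ?_) ?_ ?_
  · refine (key.div_const π).congr_fun fun n => ?_
    rw [integral_const_mul, ← Gamma_eq_integral (by positivity),
      Real.inv_Gamma_one_sub (by positivity)]
    ring
  · filter_upwards [ae_restrict_mem measurableSet_Ioi] with t (ht : 0 < t)
    rw [norm_mul, norm_mul, norm_div, norm_pow, norm_neg, norm_of_nonneg hx, norm_natCast,
      norm_of_nonneg (by positivity : 0 ≤ exp (-t) * t ^ (ν * (n + 1) - 1)), norm_eq_abs (sin _),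
      rpow_mul_natCast_add_one_sub_one ht]
    have hf : (n.factorial : ℝ) ≤ (n + 1).factorial := by
      exact_mod_cast Nat.factorial_le n.le_succ
    calc _ ≤ x ^ (n + 1) / n.factorial * 1 * (exp (-t) * (t ^ (ν - 1) * (t ^ ν) ^ n)) := by
          gcongr
          exact abs_sin_le_one _
      _ = _ := by rw [mul_pow]; ring
  · exact (summable_pow_div_factorial _).mul_left _
  · refine ((integrableOn_exp_neg_mul_rpow_mul_exp h0 h1 hx).const_mul x).congr
      (Eventually.of_forall fun t => ?_)
    simp only
    rw [tsum_mul_left, exp_eq_exp_ℝ, NormedSpace.exp_eq_tsum_div]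
    ring
  · filter_upwards [ae_restrict_mem measurableSet_Ioi] with t (ht : 0 < t)
    exact hasSum_hankelIntegrand ht

theorem integral_mainardi_eq_hankel {ν x : ℝ} (h0 : 0 < ν) (h1 : ν < 1) (hx : 0 ≤ x) :
    ∫ u in (0 : ℝ)..x, mainardi ν u = -((∫ t in Ioi 0, hankelIntegrand ν x t) / π) := by
  have hs := summable_pow_div_factorial_mul_Gamma h0 h1 hx
  have hb (n : ℕ) (u : ℝ) (hu : u ∈ uIoc 0 x) :
      ‖(-u) ^ n / ((n.factorial : ℝ) * Gamma (1 - ν - ν * n))‖ ≤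
        x ^ n / n.factorial * Gamma (ν * (n + 1)) := by
    rw [uIoc_of_le hx] at hu
    have hG : 0 < Gamma (ν * (n + 1)) := Gamma_pos_of_pos (by positivity)
    rw [show 1 - ν - ν * n = 1 - ν * (n + 1) by ring, ← div_div, div_eq_mul_inv _ (Gamma _),
      Real.inv_Gamma_one_sub (by positivity), norm_mul, norm_div, norm_div, norm_mul, norm_pow,
      norm_neg, norm_of_nonneg hu.1.le, norm_natCast, norm_of_nonneg hG.le,
      norm_of_nonneg pi_pos.le, norm_eq_abs, mul_div_assoc]
    have h2 : |sin (π * (ν * (n + 1)))| / π ≤ 1 :=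
      div_le_one_of_le₀ ((abs_sin_le_one _).trans (by linarith [pi_gt_three])) pi_pos.le
    have := hu.1.le
    have := hu.2
    calc _ ≤ x ^ n / n.factorial * (Gamma (ν * (n + 1)) * 1) := by gcongr
      _ = _ := by ring
  have key := intervalIntegral.hasSum_integral_of_dominated_convergence (μ := volume)
    (F := fun (n : ℕ) (u : ℝ) => (-u) ^ n / ((n.factorial : ℝ) * Gamma (1 - ν - ν * n)))
    (f := mainardi ν) (a := 0) (b := x)
    (fun n _ => x ^ n / n.factorial * Gamma (ν * (n + 1)))
    (fun n => by fun_prop) (fun n => Eventually.of_forall (hb n))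
    (Eventually.of_forall fun _ _ => hs) intervalIntegrable_const
    (Eventually.of_forall fun u hu => (Summable.of_norm_bounded hs fun n => hb n u hu).hasSum)
  refine key.unique ?_
  refine (hasSum_integral_hankelIntegrand h0 h1 hx).neg.congr_fun fun n => ?_
  rw [intervalIntegral.integral_div, show 1 - ν - ν * n = 1 - ν * (n + 1) by ring]
  have : ∫ u in (0 : ℝ)..x, (-u) ^ n = (-1) ^ n * (x ^ (n + 1) / (n + 1)) := by
    rw [show (fun u : ℝ => (-u) ^ n) = fun u => (-1) ^ n * u ^ n from
      funext fun u => neg_pow u n, intervalIntegral.integral_const_mul, integral_pow]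
    simp
  rw [this, neg_pow x (n + 1), Nat.factorial_succ]
  push_cast
  field_simp
  ring

/-- Kanter's function, the exponent of `s - x s ^ ν` along its steepest descent path. -/
noncomputable def kanter (ν φ : ℝ) : ℝ :=
  sin ((1 - ν) * φ) / sin (ν * φ) * (sin (ν * φ) / sin φ) ^ (1 / (1 - ν))

theorem sin_mul_pos_of_mem_Ioo {ν φ : ℝ} (h0 : 0 < ν) (h1 : ν ≤ 1) (hφ : φ ∈ Ioo 0 π) :
    0 < sin (ν * φ) :=
  sin_pos_of_pos_of_lt_pi (mul_pos h0 hφ.1) (by nlinarith [hφ.1, hφ.2])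

theorem kanter_pos {ν φ : ℝ} (h0 : 0 < ν) (h1 : ν < 1) (hφ : φ ∈ Ioo 0 π) : 0 < kanter ν φ := by
  have := sin_mul_pos_of_mem_Ioo h0 h1.le hφ
  have := sin_mul_pos_of_mem_Ioo (sub_pos.2 h1) (by linarith) hφ
  have := sin_pos_of_mem_Ioo hφ
  unfold kanter
  positivity

theorem measurable_kanter (ν : ℝ) : Measurable (kanter ν) := by
  unfold kanter
  fun_prop

theorem intervalIntegrable_exp_neg_kanter {ν c : ℝ} (h0 : 0 < ν) (h1 : ν < 1) (hc : 0 ≤ c) :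
    IntervalIntegrable (fun φ => exp (-(c * kanter ν φ))) volume 0 π := by
  rw [intervalIntegrable_iff_integrableOn_Ioo_of_le pi_pos.le]
  refine (integrableOn_const (C := (1 : ℝ)) (by simp)).mono'
    ((measurable_kanter ν).const_mul c).neg.exp.aestronglyMeasurable ?_
  filter_upwards [ae_restrict_mem measurableSet_Ioo] with φ hφ
  have := kanter_pos h0 h1 hφ
  rw [norm_of_nonneg (by positivity), exp_le_one_iff]
  nlinarith [mul_nonneg hc this.le]

/-- The logarithm of the modulus of the steepest descent path, as a function of the angle. -/
noncomputable def logRadius (ν x φ : ℝ) : ℝ :=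
  log (x * (sin (ν * φ) / sin φ)) / (1 - ν)

theorem differentiableAt_logRadius {ν x φ : ℝ} (h0 : 0 < ν) (h1 : ν < 1) (hx : 0 < x)
    (hφ : φ ∈ Ioo 0 π) : DifferentiableAt ℝ (logRadius ν x) φ := by
  have h2 := sin_mul_pos_of_mem_Ioo h0 h1.le hφ
  have h3 := sin_pos_of_mem_Ioo hφ
  have h4 : x * (sin (ν * φ) / sin φ) ≠ 0 := by positivity
  have h5 := h3.ne'
  unfold logRadius
  fun_prop (disch := assumption)

theorem tendsto_logRadius_pi {ν x : ℝ} (h0 : 0 < ν) (h1 : ν < 1) (hx : 0 < x) :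
    Tendsto (logRadius ν x) (nhdsWithin π (Iio π)) atTop := by
  have hs : Tendsto sin (nhdsWithin π (Iio π)) (nhdsWithin 0 (Ioi 0)) := by
    refine tendsto_nhdsWithin_iff.2 ⟨?_, ?_⟩
    · simpa using (continuous_sin.tendsto π).mono_left nhdsWithin_le_nhds
    · filter_upwards [Ioo_mem_nhdsLT pi_pos] with φ hφ using sin_pos_of_mem_Ioo hφ
  have hn : Tendsto (fun φ => sin (ν * φ)) (nhdsWithin π (Iio π)) (nhds (sin (ν * π))) :=
    (Continuous.tendsto (by fun_prop) π).mono_left nhdsWithin_le_nhds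
  have hp : 0 < sin (ν * π) := sin_pos_of_pos_of_lt_pi (by positivity) (by nlinarith [pi_pos])
  have := (hn.pos_mul_atTop hp (tendsto_inv_nhdsGT_zero.comp hs)).const_mul_atTop hx
  exact (tendsto_log_atTop.comp this).atTop_div_const (sub_pos.2 h1)

theorem tendsto_logRadius_zero {ν x : ℝ} (h0 : 0 < ν) (hx : 0 < x) :
    Tendsto (logRadius ν x) (nhdsWithin 0 (Ioi 0)) (nhds (log (x * ν) / (1 - ν))) := by
  have hs (a : ℝ) : Tendsto (fun φ => φ⁻¹ * sin (a * φ)) (nhdsWithin 0 (Ioi 0)) (nhds a) := by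
    have : HasDerivAt (fun φ => sin (a * φ)) a 0 := by
      simpa using ((hasDerivAt_id (0 : ℝ)).const_mul a).sin
    simpa using this.tendsto_slope_zero_right
  have hq := (hs ν).div (hs 1) one_ne_zero
  have hq' : Tendsto (fun φ => sin (ν * φ) / sin φ) (nhdsWithin 0 (Ioi 0)) (nhds ν) := by
    rw [div_one] at hq
    refine hq.congr' ?_
    filter_upwards [self_mem_nhdsWithin] with φ (hφ : 0 < φ)
    simp only [Pi.div_apply, one_mul]
    rw [mul_div_mul_left _ _ (inv_ne_zero hφ.ne')]
  exact ((hq'.const_mul x).log (by positivity)).div_const _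

/-- The phase `s - x s ^ ν` in the logarithmic coordinate `s = exp w`. -/
noncomputable def hankelPhase (ν x : ℝ) (w : ℂ) : ℂ :=
  Complex.exp w - x * Complex.exp (ν * w)

theorem differentiable_hankelPhase (ν x : ℝ) : Differentiable ℂ (hankelPhase ν x) := by
  unfold hankelPhase
  fun_prop

theorem hankelPhase_re (ν x u θ : ℝ) : (hankelPhase ν x (u + θ * Complex.I)).re =
    exp u * cos θ - x * (exp (ν * u) * cos (ν * θ)) := by
  simp [hankelPhase, Complex.exp_re]

theorem hankelPhase_im (ν x u θ : ℝ) : (hankelPhase ν x (u + θ * Complex.I)).im =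
    exp u * sin θ - x * (exp (ν * u) * sin (ν * θ)) := by
  simp [hankelPhase, Complex.exp_im]

theorem hankelPhase_logRadius {ν x φ : ℝ} (h0 : 0 < ν) (h1 : ν < 1) (hx : 0 < x)
    (hφ : φ ∈ Ioo 0 π) : hankelPhase ν x (logRadius ν x φ + φ * Complex.I) =
      ((-(x ^ (1 / (1 - ν)) * kanter ν φ) : ℝ) : ℂ) := by
  have h2 := sin_mul_pos_of_mem_Ioo h0 h1.le hφ
  have h3 := sin_pos_of_mem_Ioo hφ
  have h4 : 0 < sin (ν * φ) / sin φ := by positivity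
  have h5 : 1 - ν ≠ 0 := by linarith
  have hu : exp (logRadius ν x φ) = x ^ (1 / (1 - ν)) * (sin (ν * φ) / sin φ) ^ (1 / (1 - ν)) := by
    rw [← mul_rpow hx.le h4.le, rpow_def_of_pos (by positivity), logRadius, mul_one_div]
  have hv : exp (ν * logRadius ν x φ) * (x * (sin (ν * φ) / sin φ)) = exp (logRadius ν x φ) := by
    rw [← exp_log (by positivity : 0 < x * (sin (ν * φ) / sin φ)), ← exp_add, logRadius]
    congr 1
    field_simp
    ring
  have hv' : x * exp (ν * logRadius ν x φ) = exp (logRadius ν x φ) * sin φ / sin (ν * φ) := by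
    rw [← hv]; field_simp
  refine Complex.ext ?_ ?_
  · rw [hankelPhase_re, Complex.ofReal_re, ← mul_assoc, hv', kanter, sub_mul, one_mul, sin_sub]
    rw [show x ^ (1 / (1 - ν)) * ((sin φ * cos (ν * φ) - cos φ * sin (ν * φ)) / sin (ν * φ) *
      (sin (ν * φ) / sin φ) ^ (1 / (1 - ν))) = x ^ (1 / (1 - ν)) *
      (sin (ν * φ) / sin φ) ^ (1 / (1 - ν)) *
      ((sin φ * cos (ν * φ) - cos φ * sin (ν * φ)) / sin (ν * φ)) by ring, ← hu]
    field_simp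
    ring
  · rw [hankelPhase_im, Complex.ofReal_im, ← mul_assoc, hv']
    field_simp
    ring

section Contour

variable {ν x : ℝ} {H : ℂ → ℂ}

theorem hasDerivAt_im_comp {f : ℂ → ℂ} (hH : ∀ w, HasDerivAt H (f w) w) {γ : ℝ → ℂ} {γ' : ℂ}
    {t : ℝ} (hγ : HasDerivAt γ γ' t) : HasDerivAt (fun s => (H (γ s)).im) (γ' * f (γ t)).im t :=
  Complex.imCLM.hasFDerivAt.comp_hasDerivAt t ((hH (γ t)).scomp t hγ)

theorem im_primitive_ofReal (hH : ∀ w, HasDerivAt H (Complex.exp (hankelPhase ν x w)) w) (u : ℝ) :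
    (H u).im = (H 0).im := by
  have hd (u : ℝ) : HasDerivAt (fun s : ℝ => (H s).im) 0 u := by
    have hγ : HasDerivAt (fun s : ℝ => (s : ℂ)) 1 u := (hasDerivAt_id u).ofReal_comp
    refine (hasDerivAt_im_comp hH hγ).congr_deriv ?_
    have h := hankelPhase_im ν x u 0
    simp only [Complex.ofReal_zero, zero_mul, add_zero, sin_zero, mul_zero, sub_zero] at h
    rw [one_mul, Complex.exp_im, h, sin_zero, mul_zero]
  simpa using is_const_of_deriv_eq_zero (fun u => (hd u).differentiableAt)
    (fun u => (hd u).deriv) u 0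

theorem hasDerivAt_vertical {f : ℂ → ℂ} (hH : ∀ w, HasDerivAt H (f w) w) (u θ : ℝ) :
    HasDerivAt (fun s : ℝ => H (u + s * Complex.I)) (Complex.I * f (u + θ * Complex.I)) θ := by
  have hγ : HasDerivAt (fun s : ℝ => (u + s * Complex.I : ℂ)) Complex.I θ := by
    simpa using ((Complex.ofRealCLM.hasDerivAt (x := θ)).mul_const Complex.I).const_add (u : ℂ)
  exact (hH _).scomp θ hγ

theorem tendsto_im_primitive_atBot (h0 : 0 < ν)
    (hH : ∀ w, HasDerivAt H (Complex.exp (hankelPhase ν x w)) w) :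
    Tendsto (fun u : ℝ => (H (u + π * Complex.I)).im) atBot (nhds ((H 0).im + π)) := by
  set b : ℝ → ℝ := fun u => exp u + |x| * exp (ν * u)
  have hb : Tendsto b atBot (nhds 0) := by
    have h2 : Tendsto (fun u => exp (ν * u)) atBot (nhds 0) :=
      tendsto_exp_atBot.comp (tendsto_id.const_mul_atBot h0)
    simpa using tendsto_exp_atBot.add (h2.const_mul |x|)
  have hG (u θ : ℝ) : ‖Complex.exp (hankelPhase ν x (u + θ * Complex.I)) - 1‖ ≤
      b u * exp (b u) := by
    have hz : ‖hankelPhase ν x (u + θ * Complex.I)‖ ≤ b u := by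
      refine (norm_sub_le _ _).trans_eq ?_
      rw [norm_mul, Complex.norm_exp, Complex.norm_exp, Complex.norm_real]
      simp [b]
    have h := Complex.norm_exp_sub_sum_le_norm_mul_exp (hankelPhase ν x (u + θ * Complex.I)) 1
    simp only [Finset.range_one, Finset.sum_singleton, pow_zero, Nat.factorial_zero, Nat.cast_one,
      div_one, pow_one] at h
    exact h.trans (by gcongr)
  have hdiff (u : ℝ) : |(H (u + π * Complex.I)).im - ((H 0).im + π)| ≤ b u * exp (b u) * π := by
    have hd (θ : ℝ) : HasDerivAt (fun s : ℝ => H (u + s * Complex.I) - s * Complex.I)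
        (Complex.I * (Complex.exp (hankelPhase ν x (u + θ * Complex.I)) - 1)) θ := by
      refine ((hasDerivAt_vertical hH u θ).fun_sub
        ((Complex.ofRealCLM.hasDerivAt (x := θ)).mul_const Complex.I)).congr_deriv ?_
      simp [mul_sub]
    have h := norm_image_sub_le_of_norm_deriv_le_segment'
      (fun θ _ => (hd θ).hasDerivWithinAt (s := Icc 0 π)) (C := b u * exp (b u))
      (fun θ _ => by simpa using hG u θ) π (right_mem_Icc.2 pi_pos.le)
    refine le_trans (le_of_eq ?_) ((Complex.abs_im_le_norm _).trans (h.trans_eq (by simp)))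
    simp only [Complex.ofReal_zero, zero_mul, add_zero, sub_zero, Complex.sub_im,
      im_primitive_ofReal hH u, Complex.im_ofReal_mul, Complex.I_im, mul_one]
    congr 1
    ring
  rw [tendsto_iff_norm_sub_tendsto_zero]
  refine squeeze_zero (fun _ => norm_nonneg _) hdiff ?_
  have := (hb.mul (continuous_exp.continuousAt.tendsto.comp hb)).mul_const π
  simpa using this

theorem hasDerivAt_im_primitive_log (hH : ∀ w, HasDerivAt H (Complex.exp (hankelPhase ν x w)) w)
    {t : ℝ} (ht : 0 < t) :
    HasDerivAt (fun s : ℝ => (H (log s + π * Complex.I)).im) (hankelIntegrand ν x t) t := by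
  have hγ : HasDerivAt (fun s : ℝ => ((log s : ℝ) + π * Complex.I : ℂ)) ((t⁻¹ : ℝ) : ℂ) t :=
    (hasDerivAt_log ht.ne').ofReal_comp.add_const _
  convert hasDerivAt_im_comp hH hγ using 1
  have hp : hankelPhase ν x (log t + π * Complex.I) =
      (-t : ℝ) + -x * (t ^ ν : ℝ) * Complex.exp (π * ν * Complex.I) := by
    rw [hankelPhase, mul_add, Complex.exp_add, Complex.exp_add, Complex.exp_pi_mul_I,
      ← Complex.ofReal_exp, exp_log ht, ← Complex.ofReal_mul, ← Complex.ofReal_exp,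
      mul_comm ν (log t), ← rpow_def_of_pos ht]
    push_cast
    ring_nf
  rw [hp, Complex.exp_add, ← Complex.ofReal_exp, Complex.im_ofReal_mul, Complex.im_ofReal_mul,
    hankelIntegrand]
  ring

theorem tendsto_im_primitive_log (h0 : 0 < ν) (h1 : ν < 1) (hx : 0 ≤ x)
    (hH : ∀ w, HasDerivAt H (Complex.exp (hankelPhase ν x w)) w) :
    Tendsto (fun s : ℝ => (H (log s + π * Complex.I)).im) atTop
      (nhds ((H 0).im + π + ∫ t in Ioi 0, hankelIntegrand ν x t)) := by
  have hint := integrableOn_hankelIntegrand h0 h1 hx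
  have hd (t : ℝ) (ht : t ∈ Ioi 0) := hasDerivAt_im_primitive_log hH ht
  have hlim := tendsto_limUnder_of_hasDerivAt_of_integrableOn_Ioi hd hint
  set k := fun s : ℝ => (H (log s + π * Complex.I)).im
  have hk0 : Tendsto k (nhdsWithin 0 (Ioi 0)) (nhds ((H 0).im + π)) :=
    (tendsto_im_primitive_atBot h0 hH).comp tendsto_log_nhdsGT_zero
  have heq (t : ℝ) (ht : 0 < t) : Function.update k 0 ((H 0).im + π) t = k t :=
    Function.update_of_ne ht.ne' _ _
  have h := integral_Ioi_of_hasDerivAt_of_tendsto (a := 0)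
    (f := Function.update k 0 ((H 0).im + π)) (f' := hankelIntegrand ν x)
    (m := limUnder atTop k) ?_ ?_ hint ?_
  · rw [Function.update_self] at h
    rw [h, add_sub_cancel]
    exact hlim
  · rw [continuousWithinAt_update_same, Ici_sdiff_left]
    exact hk0
  · intro t ht
    refine (hd t ht).congr_of_eventuallyEq ?_
    filter_upwards [Ioi_mem_nhds ht] with s hs using heq s hs
  · refine hlim.congr' ?_
    filter_upwards [eventually_gt_atTop 0] with s hs using (heq s hs).symm

theorem tendsto_im_primitive_logRadius_pi (h0 : 0 < ν) (h1 : ν < 1) (hx : 0 < x)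
    (hH : ∀ w, HasDerivAt H (Complex.exp (hankelPhase ν x w)) w) :
    Tendsto (fun φ : ℝ => (H (logRadius ν x φ + φ * Complex.I)).im) (nhdsWithin π (Iio π))
      (nhds ((H 0).im + π + ∫ t in Ioi 0, hankelIntegrand ν x t)) := by
  have hline : Tendsto (fun φ : ℝ => (H (logRadius ν x φ + π * Complex.I)).im)
      (nhdsWithin π (Iio π)) (nhds ((H 0).im + π + ∫ t in Ioi 0, hankelIntegrand ν x t)) := by
    have := (tendsto_im_primitive_log h0 h1 hx.le hH).comp
      (tendsto_exp_atTop.comp (tendsto_logRadius_pi h0 h1 hx))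
    simpa [Function.comp_def] using this
  obtain ⟨C, hC⟩ := exists_mul_rpow_le_add_half h0 h1 hx.le
  have hcos : cos (2 * π / 3) = -(1 / 2) := by
    rw [show 2 * π / 3 = π - π / 3 by ring, cos_pi_sub, cos_pi_div_three]
  have hG (u θ : ℝ) (hθ : 2 * π / 3 ≤ θ) (hθ' : θ ≤ π) :
      ‖Complex.exp (hankelPhase ν x (u + θ * Complex.I))‖ ≤ exp C := by
    rw [Complex.norm_exp, hankelPhase_re, exp_le_exp]
    have h2 : cos θ ≤ -(1 / 2) :=
      hcos ▸ cos_le_cos_of_nonneg_of_le_pi (by positivity) hθ' hθ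
    have h3 := hC (exp u) (exp_pos u)
    rw [← exp_mul, mul_comm u ν] at h3
    have h4 := exp_pos u
    have h5 : 0 < x * exp (ν * u) := by positivity
    nlinarith [neg_one_le_cos (ν * θ)]
  have hdiff : ∀ᶠ φ in nhdsWithin π (Iio π), ‖(H (logRadius ν x φ + π * Complex.I)).im -
      (H (logRadius ν x φ + φ * Complex.I)).im‖ ≤ exp C * (π - φ) := by
    filter_upwards [Ioo_mem_nhdsLT (show 2 * π / 3 < π by linarith [pi_pos])] with φ hφ
    have h := norm_image_sub_le_of_norm_deriv_le_segment'
      (fun θ _ => (hasDerivAt_vertical hH (logRadius ν x φ) θ).hasDerivWithinAt (s := Icc φ π))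
      (C := exp C) (fun θ hθ => by simpa using hG _ θ (hφ.1.le.trans hθ.1) hθ.2.le)
      π (right_mem_Icc.2 hφ.2.le)
    rw [← Complex.sub_im]
    exact (Complex.abs_im_le_norm _).trans h
  have hzero : Tendsto (fun φ => exp C * (π - φ)) (nhdsWithin π (Iio π)) (nhds 0) := by
    have : Continuous fun φ => exp C * (π - φ) := by fun_prop
    simpa using (this.tendsto π).mono_left (nhdsWithin_le_nhds (s := Iio π))
  simpa using hline.sub (squeeze_zero_norm' hdiff hzero)

end Contour

theorem integral_exp_neg_kanter {ν x : ℝ} (h0 : 0 < ν) (h1 : ν < 1) (hx : 0 < x) :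
    ∫ φ in (0 : ℝ)..π, exp (-(x ^ (1 / (1 - ν)) * kanter ν φ)) =
      π + ∫ t in Ioi 0, hankelIntegrand ν x t := by
  obtain ⟨H, hH⟩ := (differentiable_hankelPhase ν x).cexp.isExactOn_univ
  replace hH (w : ℂ) := hH w (mem_univ w)
  have hd (φ : ℝ) (hφ : φ ∈ Ioo 0 π) :
      HasDerivAt (fun φ : ℝ => (H (logRadius ν x φ + φ * Complex.I)).im)
        (exp (-(x ^ (1 / (1 - ν)) * kanter ν φ))) φ := by
    have hγ : HasDerivAt (fun φ : ℝ => (logRadius ν x φ + φ * Complex.I : ℂ))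
        ((deriv (logRadius ν x) φ : ℝ) + Complex.I) φ := by
      simpa using (differentiableAt_logRadius h0 h1 hx hφ).hasDerivAt.ofReal_comp.fun_add
        ((Complex.ofRealCLM.hasDerivAt (x := φ)).mul_const Complex.I)
    convert hasDerivAt_im_comp hH hγ using 1
    rw [hankelPhase_logRadius h0 h1 hx hφ, ← Complex.ofReal_exp, Complex.im_mul_ofReal]
    simp
  have hzero : Tendsto (fun φ : ℝ => (H (logRadius ν x φ + φ * Complex.I)).im)
      (nhdsWithin 0 (Ioi 0)) (nhds (H 0).im) := by
    have hw : Tendsto (fun φ : ℝ => (logRadius ν x φ + φ * Complex.I : ℂ)) (nhdsWithin 0 (Ioi 0))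
        (nhds ((log (x * ν) / (1 - ν) : ℝ) + (0 : ℝ) * Complex.I)) :=
      ((Complex.continuous_ofReal.tendsto _).comp (tendsto_logRadius_zero h0 hx)).add
        (((Complex.continuous_ofReal.tendsto 0).mono_left nhdsWithin_le_nhds).mul_const _)
    have := (Complex.continuous_im.tendsto _).comp ((hH _).continuousAt.tendsto.comp hw)
    rw [Complex.ofReal_zero, zero_mul, add_zero, im_primitive_ofReal hH] at this
    exact this
  rw [intervalIntegral.integral_eq_sub_of_hasDerivAt_of_tendsto pi_pos hd
    (intervalIntegrable_exp_neg_kanter h0 h1 (by positivity)) hzero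
    (tendsto_im_primitive_logRadius_pi h0 h1 hx hH)]
  ring

theorem integral_mainardi_eq_kanter {ν x : ℝ} (h0 : 0 < ν) (h1 : ν < 1) (hx : 0 ≤ x) :
    ∫ u in (0 : ℝ)..x, mainardi ν u =
      1 - (∫ φ in (0 : ℝ)..π, exp (-(x ^ (1 / (1 - ν)) * kanter ν φ))) / π := by
  rcases hx.eq_or_lt with rfl | hx
  · have : 1 / (1 - ν) ≠ 0 := one_div_ne_zero (by linarith)
    rw [zero_rpow this]
    simp [pi_ne_zero]
  · rw [integral_mainardi_eq_hankel h0 h1 hx.le, integral_exp_neg_kanter h0 h1 hx]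
    field_simp
    ring

theorem tendsto_integral_exp_neg_kanter {ν : ℝ} (h0 : 0 < ν) (h1 : ν < 1) :
    Tendsto (fun c => ∫ φ in (0 : ℝ)..π, exp (-(c * kanter ν φ))) atTop (nhds 0) := by
  have hae : ∀ᵐ φ, φ ∈ uIoc 0 π → φ ∈ Ioo 0 π := by
    filter_upwards [(Set.countable_singleton π).ae_notMem volume] with φ hne hφ
    rw [uIoc_of_le pi_pos.le] at hφ
    exact ⟨hφ.1, lt_of_le_of_ne hφ.2 hne⟩
  have h := intervalIntegral.tendsto_integral_filter_of_dominated_convergence (μ := volume)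
    (F := fun c φ => exp (-(c * kanter ν φ))) (f := fun _ => (0 : ℝ)) (a := 0) (b := π)
    (l := atTop) (fun _ => (1 : ℝ)) (Eventually.of_forall fun c =>
      ((measurable_kanter ν).const_mul c).neg.exp.aestronglyMeasurable) ?_
    intervalIntegrable_const ?_
  · simpa using h
  · filter_upwards [eventually_ge_atTop 0] with c hc
    filter_upwards [hae] with φ hφ hm
    rw [norm_of_nonneg (by positivity), exp_le_one_iff]
    nlinarith [mul_nonneg hc (kanter_pos h0 h1 (hφ hm)).le]
  · filter_upwards [hae] with φ hφ hm
    exact tendsto_exp_neg_atTop_nhds_zero.comp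
      (tendsto_id.atTop_mul_const (kanter_pos h0 h1 (hφ hm)))

theorem mainardi_primitive_strictMono_tendsto_one (ν : ℝ) (hν0 : 1 / 2 ≤ ν) (hν1 : ν < 1) :
    StrictMonoOn (fun x : ℝ => ∫ u in (0 : ℝ)..x, mainardi ν u) (Ici 0) ∧
    Tendsto (fun x : ℝ => ∫ u in (0 : ℝ)..x, mainardi ν u) atTop (nhds 1) := by
  have h0 : 0 < ν := by linarith
  have hp : 0 < 1 / (1 - ν) := one_div_pos.2 (by linarith)
  refine ⟨fun x (hx : 0 ≤ x) y (hy : 0 ≤ y) hxy => ?_, ?_⟩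
  · simp only
    rw [integral_mainardi_eq_kanter h0 hν1 hx, integral_mainardi_eq_kanter h0 hν1 hy]
    have hix := intervalIntegrable_exp_neg_kanter h0 hν1 (rpow_nonneg hx (1 / (1 - ν)))
    have hiy := intervalIntegrable_exp_neg_kanter h0 hν1 (rpow_nonneg hy (1 / (1 - ν)))
    have h := intervalIntegral.intervalIntegral_pos_of_pos_on (hix.sub hiy) (fun φ hφ => ?_) pi_pos
    · rw [intervalIntegral.integral_sub hix hiy, sub_pos] at h
      gcongr
    · rw [sub_pos, exp_lt_exp, neg_lt_neg_iff]
      exact mul_lt_mul_of_pos_right (rpow_lt_rpow hx hxy hp) (kanter_pos h0 hν1 hφ)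
  · have h := (((tendsto_integral_exp_neg_kanter h0 hν1).comp
      (tendsto_rpow_atTop hp)).div_const π).const_sub 1
    rw [zero_div, sub_zero] at h
    refine h.congr' ?_
    filter_upwards [eventually_ge_atTop 0] with x hx
    exact (integral_mainardi_eq_kanter h0 hν1 hx).symm
end
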